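/- arXiv:math/0511149 — 9 statements merged into one kernel-verified Lean document; each statement's English description precedes it below -/
import Mathlib

section
/- Let A, B ∈ ℂ. Suppose y₁ is a solution of P_VI(0, A, B, 1; t₁) on an open set U ⊆ ℂ. Let V ⊆ ℂ be open with τ²∈U, τ ∉ {0,1,−1} for all τ ∈ V, and let η : V → ℂ be a differentiable function with η(τ)² = y₁(τ²) and η(τ) ≠ 1 for all τ ∈ V. Suppose Y₁ is a function, twice differentiable on a neighbourhood of the set {(τ+1)²/(τ−1)² : τ ∈ V}, satisfying Y₁((τ+1)²/(τ−1)²) = (τ+1)(η(τ)+1)/((τ−1)(η(τ)−1)) for all τ ∈ V, with (τ+1)²/(τ−1)² ∉ {0,1} and Y₁ avoiding 0, 1 and its argument there. Then Y₁ satisfies P_VI(A/2, B/2, B/2, A/2+1; T₁) at every point T₁ = (τ+1)²/(τ−1)², τ ∈ V. -/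
/-- The right-hand side of the sixth Painlevé equation with local monodromy
differences `θ0, θ1, θt, θinf` (via `α = (θ∞−1)²/2`, `β = −θ₀²/2`,
`γ = θ₁²/2`, `δ = (1−θ_t²)/2`), evaluated on the function `y` at the point `t`. -/
noncomputable def pviRHS (θ0 θ1 θt θinf : ℂ) (y : ℂ → ℂ) (t : ℂ) : ℂ :=
  (1/2) * (1/(y t) + 1/(y t - 1) + 1/(y t - t)) * (deriv y t)^2
    - (1/t + 1/(t-1) + 1/(y t - t)) * deriv y t
    + (y t * (y t - 1) * (y t - t) / (t^2 * (t-1)^2)) *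
      ((θinf - 1)^2/2 + (-(θ0^2/2)) * t/(y t)^2 + (θ1^2/2) * (t-1)/(y t - 1)^2
        + ((1 - θt^2)/2) * (t*(t-1))/(y t - t)^2)

/-- `y` satisfies the sixth Painlevé equation `P_VI(θ0,θ1,θt,θinf)` at the point `t`. -/
def PVIAt (θ0 θ1 θt θinf : ℂ) (y : ℂ → ℂ) (t : ℂ) : Prop :=
  deriv (deriv y) t = pviRHS θ0 θ1 θt θinf y t

/-- `y` is a solution of the sixth Painlevé equation `P_VI(θ0,θ1,θt,θinf;t)` on the
open set `U ⊆ ℂ`: `U` is open, `t ∉ {0,1}` and `y t ∉ {0,1,t}` on `U`, `y` is twice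
differentiable on `U`, and the Painlevé VI equation holds at every point of `U`. -/
def IsPVISolutionOn (θ0 θ1 θt θinf : ℂ) (y : ℂ → ℂ) (U : Set ℂ) : Prop :=
  IsOpen U ∧
  (∀ t ∈ U, t ≠ 0 ∧ t ≠ 1 ∧ y t ≠ 0 ∧ y t ≠ 1 ∧ y t ≠ t) ∧
  (∀ t ∈ U, DifferentiableAt ℂ y t ∧ DifferentiableAt ℂ (deriv y) t) ∧
  (∀ t ∈ U, PVIAt θ0 θ1 θt θinf y t)

/-- The denominator `Z(t)` appearing in the Okamoto transformation. -/
noncomputable def okZ (ν0 ν1 νt : ℂ) (y : ℂ → ℂ) (t : ℂ) : ℂ :=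
  ((t-1) * deriv y t - ν0) / (y t)
    - (t * deriv y t + ν1) / (y t - 1)
    + (deriv y t - 1 - νt) / (y t - t)

/-- The Okamoto operator `K_{[ν0,ν1,νt,νinf;t]} y = y + (ν0+ν1+νt+νinf)/Z`. -/
noncomputable def okK (ν0 ν1 νt νinf : ℂ) (y : ℂ → ℂ) (t : ℂ) : ℂ :=
  y t + (ν0 + ν1 + νt + νinf) / okZ ν0 ν1 νt y t

/-- Algebraic core of the transformation. -/
lemma qtm_alg (A B t x p q : ℂ) (ht0 : t ≠ 0) (ht1 : t - 1 ≠ 0) (ht2 : t + 1 ≠ 0)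
    (hx0 : x ≠ 0) (hx1 : x - 1 ≠ 0) (hx2 : x + 1 ≠ 0) (hxt : x - t ≠ 0) (hxt' : x + t ≠ 0)
    (h : (p^2 + x * q - x * p / t) / (2 * t^2) =
      (1/2) * (1/(x^2) + 1/((x-1)*(x+1)) + 1/((x-t)*(x+t))) * (x * p / t)^2
    - (1/t^2 + 1/((t-1)*(t+1)) + 1/((x-t)*(x+t))) * (x * p / t)
    + (x^2 * ((x-1)*(x+1)) * ((x-t)*(x+t)) / (t^4 * ((t-1)*(t+1))^2)) *
      ((A^2/2) * ((t-1)*(t+1))/((x-1)*(x+1))^2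
        + ((1 - B^2)/2) * (t^2*((t-1)*(t+1)))/((x-t)*(x+t))^2)) :
    ((x+1)/((x-1)*(t+1)^2) - (t-1)/(t+1)*p/(x-1)^2 + (t-1)*p/(x-1)^2
        + (t-1)^2*q/(2*(x-1)^2) - (t-1)^2*p^2/(x-1)^3) / (-4*(t+1)/(t-1)^3) =
      (1/2) * (1/((t+1)*(x+1)/((t-1)*(x-1))) + 1/(2*(x+t)/((t-1)*(x-1)))
          + 1/(-(2*(t+1)*(x-t)/((t-1)^2*(x-1)))))
        * ((t-1)*(x+1)/(2*(t+1)*(x-1)) + (t-1)^2*p/(2*(x-1)^2))^2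
    - (1/((t+1)^2/(t-1)^2) + 1/(4*t/(t-1)^2) + 1/(-(2*(t+1)*(x-t)/((t-1)^2*(x-1)))))
        * ((t-1)*(x+1)/(2*(t+1)*(x-1)) + (t-1)^2*p/(2*(x-1)^2))
    + (((t+1)*(x+1)/((t-1)*(x-1))) * (2*(x+t)/((t-1)*(x-1)))
        * (-(2*(t+1)*(x-t)/((t-1)^2*(x-1)))) / (((t+1)^2/(t-1)^2)^2 * (4*t/(t-1)^2)^2)) *
      ((A/2 + 1 - 1)^2/2 + (-((A/2)^2/2)) * ((t+1)^2/(t-1)^2)/((t+1)*(x+1)/((t-1)*(x-1)))^2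
        + ((B/2)^2/2) * (4*t/(t-1)^2)/(2*(x+t)/((t-1)*(x-1)))^2
        + ((1 - (B/2)^2)/2) * (((t+1)^2/(t-1)^2)*(4*t/(t-1)^2))
          /(-(2*(t+1)*(x-t)/((t-1)^2*(x-1))))^2) := by
  have hq : q = (2 * t^2 * ((1/2) * (1/(x^2) + 1/((x-1)*(x+1)) + 1/((x-t)*(x+t))) * (x * p / t)^2
    - (1/t^2 + 1/((t-1)*(t+1)) + 1/((x-t)*(x+t))) * (x * p / t)
    + (x^2 * ((x-1)*(x+1)) * ((x-t)*(x+t)) / (t^4 * ((t-1)*(t+1))^2)) *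
      ((A^2/2) * ((t-1)*(t+1))/((x-1)*(x+1))^2
        + ((1 - B^2)/2) * (t^2*((t-1)*(t+1)))/((x-t)*(x+t))^2)) - p^2 + x * p / t) / x := by
    rw [← h]; field_simp; ring
  rw [hq]
  clear hq h
  field_simp
  ring

/-- Lemma (Manin/RGT quadratic transformation): if `y₁` solves `P_VI(0,A,B,1;t₁)`,
`η(τ)² = y₁(τ²)`, and `Y₁((τ+1)²/(τ−1)²) = (τ+1)(η+1)/((τ−1)(η−1))`, then `Y₁`
solves `P_VI(A/2,B/2,B/2,A/2+1)` at the points `T₁ = (τ+1)²/(τ−1)²`. -/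
theorem quadratic_transformation_manin
    (A B : ℂ) (U : Set ℂ) (y₁ : ℂ → ℂ)
    (hy₁ : IsPVISolutionOn 0 A B 1 y₁ U)
    (V : Set ℂ) (hVopen : IsOpen V)
    (hV : ∀ τ ∈ V, τ^2 ∈ U ∧ τ ≠ 0 ∧ τ ≠ 1 ∧ τ ≠ -1)
    (η : ℂ → ℂ) (hηdiff : ∀ τ ∈ V, DifferentiableAt ℂ η τ)
    (hη : ∀ τ ∈ V, (η τ)^2 = y₁ (τ^2) ∧ η τ ≠ 1)
    (Y₁ : ℂ → ℂ) (W : Set ℂ) (hWopen : IsOpen W)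
    (hWsub : ∀ τ ∈ V, (τ+1)^2/(τ-1)^2 ∈ W)
    (hYdiff : ∀ T ∈ W, DifferentiableAt ℂ Y₁ T ∧ DifferentiableAt ℂ (deriv Y₁) T)
    (hYeq : ∀ τ ∈ V, Y₁ ((τ+1)^2/(τ-1)^2) = (τ+1)*(η τ+1)/((τ-1)*(η τ-1)))
    (havoid : ∀ τ ∈ V, (τ+1)^2/(τ-1)^2 ≠ 0 ∧ (τ+1)^2/(τ-1)^2 ≠ 1 ∧
      Y₁ ((τ+1)^2/(τ-1)^2) ≠ 0 ∧ Y₁ ((τ+1)^2/(τ-1)^2) ≠ 1 ∧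
      Y₁ ((τ+1)^2/(τ-1)^2) ≠ (τ+1)^2/(τ-1)^2) :
    ∀ τ ∈ V, PVIAt (A/2) (B/2) (B/2) (A/2+1) Y₁ ((τ+1)^2/(τ-1)^2) := by
  obtain ⟨hUo, hUne, hUd, hUeq⟩ := hy₁
  -- nonvanishing facts
  have hne : ∀ τ ∈ V, τ ≠ 0 ∧ τ - 1 ≠ 0 ∧ τ + 1 ≠ 0 ∧ η τ ≠ 0 ∧ η τ - 1 ≠ 0 ∧ η τ + 1 ≠ 0 ∧
      η τ - τ ≠ 0 ∧ η τ + τ ≠ 0 := by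
    intro τ hτ
    obtain ⟨hU, h0, h1, h2⟩ := hV τ hτ
    obtain ⟨he, he1⟩ := hη τ hτ
    obtain ⟨-, -, k0, k1, kt⟩ := hUne _ hU
    rw [← he] at k0 k1 kt
    refine ⟨h0, sub_ne_zero.2 h1, fun h => h2 (eq_neg_of_add_eq_zero_left h), fun h => k0 (by rw [h]; ring),
      sub_ne_zero.2 he1, fun h => k1 ?_, fun h => kt ?_, fun h => kt ?_⟩
    · linear_combination (η τ - 1) * h
    · linear_combination (η τ + τ) * h
    · linear_combination (η τ - τ) * h
  -- first derivative of y₁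
  have hsq : ∀ τ : ℂ, HasDerivAt (fun s : ℂ => s^2) (2 * τ) τ := by
    intro τ; simpa using hasDerivAt_pow 2 τ
  have hy' : ∀ τ ∈ V, deriv y₁ (τ^2) = η τ * deriv η τ / τ := by
    intro τ hτ
    obtain ⟨h0, -⟩ := hne τ hτ
    have e1 : HasDerivAt (fun s => y₁ (s^2)) (deriv y₁ (τ^2) * (2 * τ)) τ :=
      ((hUd _ (hV τ hτ).1).1.hasDerivAt).comp τ (hsq τ)
    have e2 : HasDerivAt (fun s => η s ^ 2) (2 * η τ * deriv η τ) τ := by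
      exact ((hηdiff τ hτ).hasDerivAt.pow 2).congr_deriv (by simp)
    have e3 : (fun s => η s ^ 2) =ᶠ[nhds τ] (fun s => y₁ (s^2)) := by
      filter_upwards [hVopen.mem_nhds hτ] with s hs using (hη s hs).1
    have := (e1.congr_of_eventuallyEq e3).unique e2
    field_simp
    linear_combination this / 2
  -- η is twice differentiable
  have hη2 : ∀ τ ∈ V, DifferentiableAt ℂ (deriv η) τ := by
    intro τ hτ
    have e3 : deriv η =ᶠ[nhds τ] (fun s => s * deriv y₁ (s^2) / η s) := by
      filter_upwards [hVopen.mem_nhds hτ] with s hs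
      obtain ⟨h0, -, -, h3, -⟩ := hne s hs
      rw [hy' s hs]; field_simp
    have e1 : DifferentiableAt ℂ (fun s => deriv y₁ (s^2)) τ :=
      (HasDerivAt.comp (h₂ := deriv y₁) τ ((hUd _ (hV τ hτ).1).2.hasDerivAt) (hsq τ)).differentiableAt
    have e4 : DifferentiableAt ℂ (fun s => s * deriv y₁ (s^2) / η s) τ :=
      (differentiableAt_id.mul e1).div (hηdiff τ hτ) (hne τ hτ).2.2.2.1
    exact e4.congr_of_eventuallyEq e3
  have hy'' : ∀ τ ∈ V, deriv (deriv y₁) (τ^2) =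
      ((deriv η τ)^2 + η τ * deriv (deriv η) τ - η τ * deriv η τ / τ) / (2 * τ^2) := by
    intro τ hτ
    obtain ⟨h0, -⟩ := hne τ hτ
    have e1 : HasDerivAt (fun s => deriv y₁ (s^2)) (deriv (deriv y₁) (τ^2) * (2 * τ)) τ :=
      HasDerivAt.comp (h₂ := deriv y₁) τ ((hUd _ (hV τ hτ).1).2.hasDerivAt) (hsq τ)
    have e2 := (((hηdiff τ hτ).hasDerivAt.mul (hη2 τ hτ).hasDerivAt).div (hasDerivAt_id τ) h0)
    have e3 : (fun s => deriv y₁ (s^2)) =ᶠ[nhds τ] ((η * deriv η) / id) := by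
      filter_upwards [hVopen.mem_nhds hτ] with s hs
      rw [hy' s hs]; simp
    have := e1.unique (e2.congr_of_eventuallyEq e3)
    simp only [Pi.mul_apply, id] at this
    field_simp at this ⊢
    linear_combination this
  -- derivative of the base change
  have hφ : ∀ τ ∈ V, HasDerivAt (fun s : ℂ => (s+1)^2/(s-1)^2) (-4*(τ+1)/(τ-1)^3) τ := by
    intro τ hτ
    obtain ⟨h0, h1, -⟩ := hne τ hτ
    have := (((hasDerivAt_id τ).add_const 1).pow 2).div (((hasDerivAt_id τ).sub_const 1).pow 2)
      (pow_ne_zero 2 h1)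
    refine this.congr_deriv ?_
    simp
    field_simp
    ring
  have hφ0 : ∀ τ ∈ V, -4*(τ+1)/(τ-1)^3 ≠ 0 := by
    intro τ hτ
    obtain ⟨h0, h1, h2, -⟩ := hne τ hτ
    exact div_ne_zero (mul_ne_zero (by norm_num) h2) (pow_ne_zero 3 h1)
  have hY' : ∀ τ ∈ V, deriv Y₁ ((τ+1)^2/(τ-1)^2) =
      (τ-1)*(η τ+1)/(2*(τ+1)*(η τ-1)) + (τ-1)^2*deriv η τ/(2*(η τ-1)^2) := by
    intro τ hτ
    obtain ⟨h0, h1, h2, h3, h4, h5, -⟩ := hne τ hτ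
    have e1 : HasDerivAt (fun s => Y₁ ((s+1)^2/(s-1)^2))
        (deriv Y₁ ((τ+1)^2/(τ-1)^2) * (-4*(τ+1)/(τ-1)^3)) τ :=
      HasDerivAt.comp τ ((hYdiff _ (hWsub τ hτ)).1.hasDerivAt) (hφ τ hτ)
    have e2 := (((hasDerivAt_id τ).add_const 1).mul ((hηdiff τ hτ).hasDerivAt.add_const 1)).div
      (((hasDerivAt_id τ).sub_const 1).mul ((hηdiff τ hτ).hasDerivAt.sub_const 1))
      (mul_ne_zero h1 h4)
    have e3 := e2.congr_of_eventuallyEq (f₁ := fun s => Y₁ ((s+1)^2/(s-1)^2)) (by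
      filter_upwards [hVopen.mem_nhds hτ] with s hs
      rw [hYeq s hs]; simp)
    have := e1.unique e3
    refine mul_right_cancel₀ (hφ0 τ hτ) (this.trans ?_)
    simp
    field_simp
    ring
  have hY'' : ∀ τ ∈ V, deriv (deriv Y₁) ((τ+1)^2/(τ-1)^2) =
      ((η τ+1)/((η τ-1)*(τ+1)^2) - (τ-1)/(τ+1)*deriv η τ/(η τ-1)^2 + (τ-1)*deriv η τ/(η τ-1)^2
        + (τ-1)^2*deriv (deriv η) τ/(2*(η τ-1)^2) - (τ-1)^2*(deriv η τ)^2/(η τ-1)^3)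
        / (-4*(τ+1)/(τ-1)^3) := by
    intro τ hτ
    obtain ⟨h0, h1, h2, h3, h4, h5, -⟩ := hne τ hτ
    have e1 : HasDerivAt (fun s => deriv Y₁ ((s+1)^2/(s-1)^2))
        (deriv (deriv Y₁) ((τ+1)^2/(τ-1)^2) * (-4*(τ+1)/(τ-1)^3)) τ :=
      HasDerivAt.comp (h₂ := deriv Y₁) τ ((hYdiff _ (hWsub τ hτ)).2.hasDerivAt) (hφ τ hτ)
    have d1 := (hηdiff τ hτ).hasDerivAt
    have e2 := ((((hasDerivAt_id τ).sub_const 1).mul (d1.add_const 1)).div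
      ((((hasDerivAt_id τ).add_const 1).const_mul 2).mul (d1.sub_const 1))
      (mul_ne_zero (mul_ne_zero two_ne_zero h2) h4)).add
      (((((hasDerivAt_id τ).sub_const 1).pow 2).mul (hη2 τ hτ).hasDerivAt).div
        (((d1.sub_const 1).pow 2).const_mul 2) (mul_ne_zero two_ne_zero (pow_ne_zero 2 h4)))
    have e3 := e2.congr_of_eventuallyEq (f₁ := fun s => deriv Y₁ ((s+1)^2/(s-1)^2)) (by
      filter_upwards [hVopen.mem_nhds hτ] with s hs
      rw [hY' s hs]; simp)
    have := e1.unique e3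
    rw [eq_div_iff (hφ0 τ hτ)]
    refine this.trans ?_
    simp
    field_simp
    ring
  intro τ hτ
  obtain ⟨h0, h1, h2, h3, h4, h5, h6, h7⟩ := hne τ hτ
  have hP := hUeq _ (hV τ hτ).1
  unfold PVIAt pviRHS at hP ⊢
  rw [hy'' τ hτ, hy' τ hτ, ← (hη τ hτ).1] at hP
  rw [hY'' τ hτ, hY' τ hτ, hYeq τ hτ]
  have r1 : (τ+1)*(η τ+1)/((τ-1)*(η τ-1)) - 1 = 2*(η τ+τ)/((τ-1)*(η τ-1)) := by
    field_simp; ring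
  have r2 : (τ+1)*(η τ+1)/((τ-1)*(η τ-1)) - (τ+1)^2/(τ-1)^2
      = -(2*(τ+1)*(η τ-τ)/((τ-1)^2*(η τ-1))) := by
    field_simp; ring
  have r3 : (τ+1)^2/(τ-1)^2 - 1 = 4*τ/(τ-1)^2 := by
    field_simp; ring
  rw [r1, r2, r3]
  refine qtm_alg A B τ (η τ) (deriv η τ) (deriv (deriv η) τ) h0 h1 h2 h3 h4 h5 h6 h7 ?_
  rw [hP]
  have s1 : η τ ^ 2 - 1 = (η τ - 1) * (η τ + 1) := by ring
  have s2 : η τ ^ 2 - τ ^ 2 = (η τ - τ) * (η τ + τ) := by ring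
  have s3 : τ ^ 2 - 1 = (τ - 1) * (τ + 1) := by ring
  rw [s1, s2, s3]
  ring
end

section
/- Suppose y is a solution of P_VI(θ₀, θ₁, θ_t, θ∞; t) on an open set U ⊆ ℂ, and let ν₀ ∈ {θ₀, −θ₀}, ν₁ ∈ {θ₁, −θ₁}, ν_t ∈ {θ_t, −θ_t}, ν∞ ∈ {θ∞, 2−θ∞}. Set Θ = (ν₀+ν₁+ν_t+ν∞)/2. Assume that at every t ∈ U the quantity Z(t) = ((t−1)y'(t) − ν₀)/y(t) − (t y'(t) + ν₁)/(y(t)−1) + (y'(t) − 1 − ν_t)/(y(t)−t) is nonzero, and that the function K_{[ν₀,ν₁,ν_t,ν∞;t]} y := y + (ν₀+ν₁+ν_t+ν∞)/Z avoids the values 0, 1, t on U. Then K_{[ν₀,ν₁,ν_t,ν∞;t]} y is a solution of P_VI(ν₀−Θ, ν₁−Θ, ν_t−Θ, ν∞−Θ; t) on U. -/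
/-- Hamiltonian vector field, `q` component. -/
noncomputable def okF (a b c t q p : ℂ) : ℂ :=
  (2*p*q*(q-1)*(q-t) + (1+c)*q*(q-1) + b*q*(q-t) + a*(q-1)*(q-t)) / (t*(t-1))

/-- Hamiltonian vector field, `p` component. -/
noncomputable def okG (a b c Θ t q p : ℂ) : ℂ :=
  -(p^2*(3*q^2-2*(1+t)*q+t) + p*((1+c)*(2*q-1)+b*(2*q-t)+a*(2*q-1-t))
    + Θ*(1+a+b+c-Θ)) / (t*(t-1))

set_option maxHeartbeats 4000000 in
theorem okamoto_stepB (a b c d Θ : ℂ) (hd : d = 2*Θ-a-b-c) (U : Set ℂ) (hU : IsOpen U)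
    (q p : ℂ → ℂ)
    (hne : ∀ t ∈ U, t ≠ 0 ∧ t ≠ 1 ∧ q t ≠ 0 ∧ q t ≠ 1 ∧ q t ≠ t)
    (hq : ∀ t ∈ U, HasDerivAt q (okF a b c t (q t) (p t)) t)
    (hp : ∀ t ∈ U, HasDerivAt p (okG a b c Θ t (q t) (p t)) t) :
    IsPVISolutionOn a b c d q U := by
  have key : ∀ t ∈ U, HasDerivAt (deriv q) (pviRHS a b c d q t) t := by
    intro t ht
    obtain ⟨h0, h1, hq0, hq1, hqt⟩ := hne t ht
    have h1' : t - 1 ≠ 0 := sub_ne_zero.mpr h1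
    have hq1' : q t - 1 ≠ 0 := sub_ne_zero.mpr hq1
    have hqt' : q t - t ≠ 0 := sub_ne_zero.mpr hqt
    have e : deriv q =ᶠ[nhds t] fun s => okF a b c s (q s) (p s) := by
      filter_upwards [hU.mem_nhds ht] with s hs using (hq s hs).deriv
    refine HasDerivAt.congr_of_eventuallyEq ?_ e
    have Q := hq t ht
    have P := hp t ht
    have T := hasDerivAt_id' t
    have Q1 := Q.sub_const 1
    have Qt := Q.sub T
    have N := (((((P.const_mul 2).mul Q).mul Q1).mul Qt).add
      (((Q.const_mul (1+c)).mul Q1))).add ((Q.const_mul b).mul Qt) |>.add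
      ((Q1.const_mul a).mul Qt)
    have D := N.div (T.mul (T.sub_const 1)) (mul_ne_zero h0 h1')
    refine D.congr_deriv ?_
    simp only [pviRHS, (hq t ht).deriv, Pi.mul_apply, Pi.add_apply, Pi.sub_apply, okF, okG, hd]
    generalize q t = x at *
    generalize p t = z at *
    field_simp
    ring
  refine ⟨hU, hne, fun t ht => ⟨(hq t ht).differentiableAt, (key t ht).differentiableAt⟩,
    fun t ht => (key t ht).deriv⟩

set_option maxHeartbeats 4000000 in
theorem okamoto_stepA (a b c d : ℂ) (U : Set ℂ) (q : ℂ → ℂ)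
    (h : IsPVISolutionOn a b c d q U) (t : ℂ) (ht : t ∈ U) :
    HasDerivAt q (okF a b c t (q t) (okZ a b c q t / 2)) t ∧
    HasDerivAt (fun s => okZ a b c q s / 2)
      (okG a b c ((a+b+c+d)/2) t (q t) (okZ a b c q t / 2)) t := by
  obtain ⟨hU, hne, hdiff, heq⟩ := h
  obtain ⟨h0, h1, hq0, hq1, hqt⟩ := hne t ht
  have h1' : t - 1 ≠ 0 := sub_ne_zero.mpr h1
  have hq1' : q t - 1 ≠ 0 := sub_ne_zero.mpr hq1
  have hqt' : q t - t ≠ 0 := sub_ne_zero.mpr hqt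
  have Q := (hdiff t ht).1.hasDerivAt
  have R := (hdiff t ht).2.hasDerivAt
  have E : deriv (deriv q) t = _ := heq t ht
  constructor
  · refine Q.congr_deriv ?_
    simp only [okF, okZ]
    generalize deriv q t = y at *
    generalize q t = x at *
    field_simp
    ring
  · have T := hasDerivAt_id' t
    have Q1 := Q.sub_const 1
    have Qt := Q.sub T
    have N := (((((T.sub_const 1).mul R).sub_const a).div Q hq0).sub
      (((T.mul R).add_const b).div Q1 hq1')).add
      (((R.sub_const 1).sub_const c).div Qt hqt')
    refine (N.div_const 2).congr_deriv ?_
    rw [E]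
    simp only [pviRHS, Pi.mul_apply, Pi.add_apply, Pi.sub_apply, okZ, okG]
    generalize deriv q t = y at *
    generalize q t = x at *
    field_simp
    ring

theorem okamoto_stepC1 (a b c Θ t q p : ℂ) (hp : p ≠ 0) (h0 : t ≠ 0) (h1 : t - 1 ≠ 0) :
    okF a b c t q p + (0 * p - Θ * okG a b c Θ t q p) / p^2
      = okF (a-Θ) (b-Θ) (c-Θ) t (q+Θ/p) p := by
  simp only [okF, okG]
  field_simp
  ring

theorem okamoto_stepC2 (a b c Θ t q p : ℂ) (hp : p ≠ 0) (h0 : t ≠ 0) (h1 : t - 1 ≠ 0) :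
    okG a b c Θ t q p = okG (a-Θ) (b-Θ) (c-Θ) (-Θ) t (q+Θ/p) p := by
  simp only [okG]
  field_simp
  ring

/-- Okamoto's transformation: if `y` solves `P_VI(θ0,θ1,θt,θinf)` on `U` and
`ν0 ∈ {θ0,−θ0}`, `ν1 ∈ {θ1,−θ1}`, `νt ∈ {θt,−θt}`, `νinf ∈ {θinf,2−θinf}`,
then `K_{[ν0,ν1,νt,νinf;t]} y` solves `P_VI(ν0−Θ,ν1−Θ,νt−Θ,νinf−Θ)` on `U`,
where `Θ = (ν0+ν1+νt+νinf)/2`. -/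
theorem okamoto_transformation
    (θ0 θ1 θt θinf ν0 ν1 νt νinf : ℂ)
    (hν0 : ν0 = θ0 ∨ ν0 = -θ0) (hν1 : ν1 = θ1 ∨ ν1 = -θ1)
    (hνt : νt = θt ∨ νt = -θt) (hνinf : νinf = θinf ∨ νinf = 2 - θinf)
    (U : Set ℂ) (y : ℂ → ℂ)
    (hy : IsPVISolutionOn θ0 θ1 θt θinf y U)
    (hZ : ∀ t ∈ U, okZ ν0 ν1 νt y t ≠ 0)
    (havoid : ∀ t ∈ U, okK ν0 ν1 νt νinf y t ≠ 0 ∧ okK ν0 ν1 νt νinf y t ≠ 1 ∧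
      okK ν0 ν1 νt νinf y t ≠ t) :
    IsPVISolutionOn (ν0 - (ν0+ν1+νt+νinf)/2) (ν1 - (ν0+ν1+νt+νinf)/2)
      (νt - (ν0+ν1+νt+νinf)/2) (νinf - (ν0+ν1+νt+νinf)/2)
      (fun t => okK ν0 ν1 νt νinf y t) U := by
  have hy' : IsPVISolutionOn ν0 ν1 νt νinf y U := by
    have e0 : ν0^2 = θ0^2 := by rcases hν0 with h | h <;> rw [h] <;> ring
    have e1 : ν1^2 = θ1^2 := by rcases hν1 with h | h <;> rw [h] <;> ring
    have et : νt^2 = θt^2 := by rcases hνt with h | h <;> rw [h] <;> ring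
    have ei : (νinf-1)^2 = (θinf-1)^2 := by rcases hνinf with h | h <;> rw [h] <;> ring
    simpa only [IsPVISolutionOn, PVIAt, pviRHS, e0, e1, et, ei] using hy
  have hA := okamoto_stepA ν0 ν1 νt νinf U y hy'
  obtain ⟨hU, hne, -, -⟩ := hy'
  have hK : ∀ t, okK ν0 ν1 νt νinf y t
      = y t + ((ν0+ν1+νt+νinf)/2) / (okZ ν0 ν1 νt y t / 2) := by
    intro t
    simp only [okK]
    rw [div_div_div_cancel_right₀ two_ne_zero]
  refine okamoto_stepB _ _ _ _ (-((ν0+ν1+νt+νinf)/2)) (by ring) U hU _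
    (fun s => okZ ν0 ν1 νt y s / 2) ?_ ?_ ?_
  · intro t ht
    exact ⟨(hne t ht).1, (hne t ht).2.1, havoid t ht⟩
  · intro t ht
    have hz : okZ ν0 ν1 νt y t / 2 ≠ 0 := div_ne_zero (hZ t ht) two_ne_zero
    have D := (hA t ht).1.add (((hasDerivAt_const t ((ν0+ν1+νt+νinf)/2))).div (hA t ht).2 hz)
    simp only [hK]
    refine D.congr_deriv ?_
    exact okamoto_stepC1 _ _ _ _ _ _ _ hz (hne t ht).1 (sub_ne_zero.mpr (hne t ht).2.1)
  · intro t ht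
    have hz : okZ ν0 ν1 νt y t / 2 ≠ 0 := div_ne_zero (hZ t ht) two_ne_zero
    simp only [hK]
    refine (hA t ht).2.congr_deriv ?_
    exact okamoto_stepC2 _ _ _ _ _ _ _ hz (hne t ht).1 (sub_ne_zero.mpr (hne t ht).2.1)
end

section
/- Let a, b ∈ ℂ. Suppose y₀ is a solution of P_VI(a, b−1, b, a+1; t₁) on an open set U ⊆ ℂ, and let y₁ = K_{[−a, b−1, −b, 1−a; t₁]} y₀ (assumed defined, i.e. the corresponding Z is nonzero on U). Let V ⊆ ℂ be open with τ² ∈ U, τ ∉ {0,1,−1} for all τ ∈ V, and let η : V → ℂ be differentiable with η(τ)² = y₁(τ²) for all τ ∈ V. Assume for all τ ∈ V that a·η(τ)·(y₀(τ²)−1) − (b−1)·(y₀(τ²)−η(τ)²) ≠ 0 and τ ≠ 1. Suppose Y₀ is twice differentiable on a neighbourhood of {(τ+1)²/(τ−1)² : τ ∈ V}, satisfies Y₀((τ+1)²/(τ−1)²) = a(τ+1)(η(τ)+1)(y₀(τ²)+η(τ)) / ((τ−1)(a·η(τ)(y₀(τ²)−1) − (b−1)(y₀(τ²)−η(τ)²)))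 for all τ ∈ V, and avoids 0, 1 and its argument on points (τ+1)²/(τ−1)² ∉ {0,1}. Then Y₀ satisfies P_VI(a, 1/2, 1/2, b; T₁) at every point T₁ = (τ+1)²/(τ−1)², τ ∈ V. -/
lemma ham_id (T y M c0 c1 ct e y' M' : ℂ) (hT : T ≠ 0) (hT1 : T - 1 ≠ 0) (h0 : y ≠ 0)
    (h1 : y - 1 ≠ 0) (ht : y - T ≠ 0)
    (hy' : y' = (y*(y-1)*(y-T)*M - (c0*(y-1)*(y-T) + c1*y*(y-T) + ct*y*(y-1)))/(T*(T-1)))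
    (hM' : M' = -((3*y^2-2*(1+T)*y+T)*M^2/2
      - (c0*(2*y-1-T)+c1*(2*y-T)+ct*(2*y-1))*M + ((c0+c1+ct)^2-e^2)/2)/(T*(T-1))) :
    T*(T-1)*((1/2) * (1/y + 1/(y - 1) + 1/(y - T)) * y'^2
    - (1/T + 1/(T-1) + 1/(y - T)) * y'
    + (y * (y - 1) * (y - T) / (T^2 * (T-1)^2)) *
      (e^2/2 + (-(c0^2/2)) * T/y^2 + (c1^2/2) * (T-1)/(y - 1)^2
        + ((1 - (ct+1)^2)/2) * (T*(T-1))/(y - T)^2)) + (2*T-1)*y' =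
    (y'*(y-1)*(y-T) + y*y'*(y-T) + y*(y-1)*(y'-1))*M + y*(y-1)*(y-T)*M'
    - (c0*(y'*(y-T)+(y-1)*(y'-1)) + c1*(y'*(y-T)+y*(y'-1)) + ct*(y'*(y-1)+y*y')) := by
  subst hy' hM'
  field_simp
  ring

lemma flow_Y (a b r u e D u' e' T Y M : ℂ) (hr : r ≠ 0) (hr1 : r - 1 ≠ 0) (hr2 : r + 1 ≠ 0)
    (hD0 : D ≠ 0) (hue : u - e^2 ≠ 0) (he : e + 1 ≠ 0)
    (hD : D = a*e*(u-1) - (b-1)*(u-e^2))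
    (hu' : u' = 2/(r*(r^2-1)) * (2*a*u*(u-1)*(u-r^2)/(u-e^2) - a*(u-1)*(u-r^2)
      + (b-1)*u*(1-r^2)))
    (he' : e' = e/(r*(r^2-1)) * (2*a*(e^2-1)*(e^2-r^2)/(u-e^2) + (a+b-1)*(e^2-r^2)
      + (a-b+1)*(e^2-1)))
    (hT : T = (r+1)^2/(r-1)^2)
    (hY : Y = a*(r+1)*(e+1)*(u+e)/((r-1)*D))
    (hM : M = -((r-1)*(e-1)*D/((r+1)*(e+1)*(u-e^2)))) :
    (((a*(e+1)*(u+e) + a*(r+1)*e'*(u+e) + a*(r+1)*(e+1)*(u'+e')) * ((r-1)*D)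
      - a*(r+1)*(e+1)*(u+e)*(D + (r-1)*(a*e'*(u-1) + a*e*u' - (b-1)*(u'-2*e*e'))))
      / ((r-1)*D)^2)
    = (Y*(Y-1)*(Y-T)*M - (a*(Y-1)*(Y-T) + (1/2)*Y*(Y-T) + (-1/2)*Y*(Y-1)))
      * (-(r-1)/(r*(r+1))) := by
  have h3 : r^2 - 1 ≠ 0 := by
    have : r^2-1 = (r-1)*(r+1) := by ring
    rw [this]; exact mul_ne_zero hr1 hr2
  subst hu' he' hT hY hM
  field_simp
  rw [hD]
  ring

lemma flow_M (a b r u e D u' e' T Y M : ℂ) (hr : r ≠ 0) (hr1 : r - 1 ≠ 0) (hr2 : r + 1 ≠ 0)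
    (hD0 : D ≠ 0) (hue : u - e^2 ≠ 0) (he : e + 1 ≠ 0)
    (hD : D = a*e*(u-1) - (b-1)*(u-e^2))
    (hu' : u' = 2/(r*(r^2-1)) * (2*a*u*(u-1)*(u-r^2)/(u-e^2) - a*(u-1)*(u-r^2)
      + (b-1)*u*(1-r^2)))
    (he' : e' = e/(r*(r^2-1)) * (2*a*(e^2-1)*(e^2-r^2)/(u-e^2) + (a+b-1)*(e^2-r^2)
      + (a-b+1)*(e^2-1)))
    (hT : T = (r+1)^2/(r-1)^2)
    (hY : Y = a*(r+1)*(e+1)*(u+e)/((r-1)*D))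
    (hM : M = -((r-1)*(e-1)*D/((r+1)*(e+1)*(u-e^2)))) :
    -((((e-1)*D + (r-1)*e'*D + (r-1)*(e-1)*(a*e'*(u-1) + a*e*u' - (b-1)*(u'-2*e*e')))
        * ((r+1)*(e+1)*(u-e^2))
      - (r-1)*(e-1)*D*((e+1)*(u-e^2) + (r+1)*e'*(u-e^2) + (r+1)*(e+1)*(u'-2*e*e')))
      / ((r+1)*(e+1)*(u-e^2))^2)
    = -((3*Y^2-2*(1+T)*Y+T)*M^2/2
      - (a*(2*Y-1-T)+(1/2)*(2*Y-T)+(-1/2)*(2*Y-1))*M + ((a+1/2+-1/2)^2-(b-1)^2)/2)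
      * (-(r-1)/(r*(r+1))) := by
  have h3 : r^2 - 1 ≠ 0 := by
    have : r^2-1 = (r-1)*(r+1) := by ring
    rw [this]; exact mul_ne_zero hr1 hr2
  subst hu' he' hT hY hM
  field_simp
  rw [hD]
  ring

lemma hda_congr {f : ℂ → ℂ} {f' g' x : ℂ} (h : HasDerivAt f f' x) (e : g' = f') :
    HasDerivAt f g' x := e ▸ h

lemma okZ_first (a b : ℂ) (y : ℂ → ℂ) (t : ℂ) (h0 : y t ≠ 0) (h1 : y t - 1 ≠ 0)
    (ht : y t - t ≠ 0) :
    t*(t-1)*deriv y t = y t*(y t-1)*(y t-t)*okZ (-a) (b-1) (-b) y t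
      - (a*(y t-1)*(y t-t) + (-(b-1))*y t*(y t-t) + (b-1)*y t*(y t-1)) := by
  unfold okZ
  field_simp
  ring

lemma okZ_hasDerivAt (a b : ℂ) (U : Set ℂ) (y : ℂ → ℂ)
    (hy : IsPVISolutionOn a (b-1) b (a+1) y U) (t : ℂ) (htU : t ∈ U) :
    HasDerivAt (okZ (-a) (b-1) (-b) y)
      (-((3*(y t)^2-2*(1+t)*y t+t)*(okZ (-a) (b-1) (-b) y t)^2/2
      - (a*(2*y t-1-t)+(-(b-1))*(2*y t-t)+(b-1)*(2*y t-1))*okZ (-a) (b-1) (-b) y t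
      + ((a+-(b-1)+(b-1))^2-a^2)/2)/(t*(t-1))) t := by
  obtain ⟨hU, hne, hd, hP⟩ := hy
  obtain ⟨ht0, ht1, h0, h1, h2⟩ := hne t htU
  have ht1' : t - 1 ≠ 0 := sub_ne_zero.2 ht1
  have h1' : y t - 1 ≠ 0 := sub_ne_zero.2 h1
  have h2' : y t - t ≠ 0 := sub_ne_zero.2 h2
  obtain ⟨hdy, hddy⟩ := hd t htU
  have hZd : DifferentiableAt ℂ (okZ (-a) (b-1) (-b) y) t := by
    unfold okZ
    fun_prop (disch := assumption)
  have hZ' := hZd.hasDerivAt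
  have hy' := hdy.hasDerivAt
  have hyy := hddy.hasDerivAt
  set Z := okZ (-a) (b-1) (-b) y with hZdef
  have hid := hasDerivAt_id' t
  have hL : HasDerivAt (fun s => s*(s-1)*deriv y s)
      ((1*(t-1) + t*1)*deriv y t + t*(t-1)*deriv (deriv y) t) t :=
    (hid.mul (hid.sub_const 1)).mul hyy
  have hR : HasDerivAt (fun s => y s*(y s-1)*(y s-s)*Z s
      - (a*(y s-1)*(y s-s) + (-(b-1))*y s*(y s-s) + (b-1)*y s*(y s-1))) _ t :=
    (((hy'.mul (hy'.sub_const 1)).mul (hy'.sub hid)).mul hZ').sub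
      (((((hy'.sub_const 1).const_mul a).mul (hy'.sub hid)).add
        ((hy'.const_mul (-(b-1))).mul (hy'.sub hid))).add
        ((hy'.const_mul (b-1)).mul (hy'.sub_const 1)))
  have hE : (fun s => s*(s-1)*deriv y s) =ᶠ[nhds t] (fun s => y s*(y s-1)*(y s-s)*Z s
      - (a*(y s-1)*(y s-s) + (-(b-1))*y s*(y s-s) + (b-1)*y s*(y s-1))) := by
    filter_upwards [hU.mem_nhds htU] with s hs
    obtain ⟨_, _, k0, k1, k2⟩ := hne s hs
    exact okZ_first a b y s k0 (sub_ne_zero.2 k1) (sub_ne_zero.2 k2)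
  have hu := hL.unique (hR.congr_of_eventuallyEq hE)
  simp only [Pi.sub_apply, Pi.mul_apply] at hu
  have hfirst : deriv y t = _ / (t*(t-1)) :=
    (eq_div_iff (mul_ne_zero ht0 ht1')).2 ((mul_comm _ _).trans (okZ_first a b y t h0 h1' h2'))
  have hham := ham_id t (y t) (Z t) a (-(b-1)) (b-1) a (deriv y t) _ ht0 ht1' h0 h1' h2' hfirst rfl
  have hPt := hP t htU
  unfold PVIAt pviRHS at hPt
  rw [show a + 1 - 1 = a by ring] at hPt
  rw [neg_sq, show b - 1 + 1 = b by ring] at hham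
  rw [← hPt] at hham
  refine hda_congr (hZ') ?_
  have hN : y t*(y t-1)*(y t-t) ≠ 0 := mul_ne_zero (mul_ne_zero h0 h1') h2'
  apply mul_left_cancel₀ hN
  linear_combination hu - hham

lemma y1_alg (a b t y Z y' Z' e2 : ℂ) (ha : a ≠ 0) (hZ : Z ≠ 0) (ht0 : t ≠ 0) (ht1 : t - 1 ≠ 0)
    (hy' : y' = (y*(y-1)*(y-t)*Z - (a*(y-1)*(y-t) + (-(b-1))*y*(y-t) + (b-1)*y*(y-1)))/(t*(t-1)))
    (hZ' : Z' = -((3*y^2-2*(1+t)*y+t)*Z^2/2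
      - (a*(2*y-1-t)+(-(b-1))*(2*y-t)+(b-1)*(2*y-1))*Z
      + ((a+-(b-1)+(b-1))^2-a^2)/2)/(t*(t-1)))
    (he : e2 = y + (-2*a)/Z) :
    y' - (-2*a)*Z'/Z^2 = e2/(t*(t-1)) * (2*a*(e2-1)*(e2-t)/(y-e2) + (a+b-1)*(e2-t)
      + (a-b+1)*(e2-1)) := by
  have h : y - e2 = 2*a/Z := by rw [he]; ring
  rw [h]
  subst hy' hZ' he
  field_simp
  ring

noncomputable def etaRHS (a b r u e : ℂ) : ℂ :=
  e/(r*(r^2-1)) * (2*a*(e^2-1)*(e^2-r^2)/(u-e^2) + (a+b-1)*(e^2-r^2) + (a-b+1)*(e^2-1))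

lemma eta_limit (V : Set ℂ) (hV : IsOpen V) (η B : ℂ → ℂ)
    (hη : ∀ τ ∈ V, DifferentiableAt ℂ η τ) (hB : ∀ τ ∈ V, ContinuousAt B τ)
    (hB0 : ∀ τ ∈ V, η τ = 0 → B τ = 0)
    (h : ∀ τ ∈ V, η τ * deriv η τ = η τ * B τ) : ∀ τ ∈ V, deriv η τ = B τ := by
  intro τ hτ
  have han : AnalyticAt ℂ η τ :=
    DifferentiableOn.analyticAt (fun x hx => (hη x hx).differentiableWithinAt) (hV.mem_nhds hτ)
  rcases han.eventually_eq_zero_or_eventually_ne_zero with h0 | h0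
  · have h1 : η =ᶠ[nhds τ] fun _ => 0 := h0
    rw [h1.deriv_eq, hB0 τ hτ h1.eq_of_nhds]
    simp
  · have h1 : deriv η =ᶠ[nhdsWithin τ {τ}ᶜ] B := by
      filter_upwards [h0, nhdsWithin_le_nhds (hV.mem_nhds hτ)] with s hs hsV
      exact mul_left_cancel₀ hs (h s hsV)
    have h2 : Filter.Tendsto (deriv η) (nhdsWithin τ {τ}ᶜ) (nhds (deriv η τ)) :=
      han.deriv.continuousAt.tendsto.mono_left nhdsWithin_le_nhds
    have h3 : Filter.Tendsto B (nhdsWithin τ {τ}ᶜ) (nhds (B τ)) :=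
      (hB τ hτ).tendsto.mono_left nhdsWithin_le_nhds
    exact tendsto_nhds_unique h2 (h3.congr' h1.symm)

set_option maxHeartbeats 4000000 in
/-- Theorem 1 of Vidunas–Kitaev: the quadratic transformation
`(a,b−1,b,a+1) ↦ (a,1/2,1/2,b)`. -/
theorem quadratic_transformation_kitaev
    (a b : ℂ) (U : Set ℂ) (y₀ : ℂ → ℂ)
    (hy₀ : IsPVISolutionOn a (b-1) b (a+1) y₀ U)
    (hZ : ∀ t ∈ U, okZ (-a) (b-1) (-b) y₀ t ≠ 0)
    (y₁ : ℂ → ℂ) (hy₁def : ∀ t ∈ U, y₁ t = okK (-a) (b-1) (-b) (1-a) y₀ t)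
    (V : Set ℂ) (hVopen : IsOpen V)
    (hV : ∀ τ ∈ V, τ^2 ∈ U ∧ τ ≠ 0 ∧ τ ≠ 1 ∧ τ ≠ -1)
    (η : ℂ → ℂ) (hηdiff : ∀ τ ∈ V, DifferentiableAt ℂ η τ)
    (hη : ∀ τ ∈ V, (η τ)^2 = y₁ (τ^2))
    (hden : ∀ τ ∈ V, a * η τ * (y₀ (τ^2) - 1) - (b-1) * (y₀ (τ^2) - (η τ)^2) ≠ 0)
    (Y₀ : ℂ → ℂ) (W : Set ℂ) (hWopen : IsOpen W)
    (hWsub : ∀ τ ∈ V, (τ+1)^2/(τ-1)^2 ∈ W)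
    (hYdiff : ∀ T ∈ W, DifferentiableAt ℂ Y₀ T ∧ DifferentiableAt ℂ (deriv Y₀) T)
    (hYeq : ∀ τ ∈ V, Y₀ ((τ+1)^2/(τ-1)^2) =
      a*(τ+1)*(η τ+1)*(y₀ (τ^2)+η τ) /
        ((τ-1)*(a*η τ*(y₀ (τ^2)-1) - (b-1)*(y₀ (τ^2)-(η τ)^2))))
    (havoid : ∀ τ ∈ V, (τ+1)^2/(τ-1)^2 ≠ 0 ∧ (τ+1)^2/(τ-1)^2 ≠ 1 ∧
      Y₀ ((τ+1)^2/(τ-1)^2) ≠ 0 ∧ Y₀ ((τ+1)^2/(τ-1)^2) ≠ 1 ∧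
      Y₀ ((τ+1)^2/(τ-1)^2) ≠ (τ+1)^2/(τ-1)^2) :
    ∀ τ ∈ V, PVIAt a (1/2) (1/2) b Y₀ ((τ+1)^2/(τ-1)^2) := by
  obtain ⟨hU, hne, hd, hP⟩ := id hy₀
  intro τ₀ hτ₀
  have ha : a ≠ 0 := by
    rintro rfl
    apply (havoid τ₀ hτ₀).2.2.1
    rw [hYeq τ₀ hτ₀]
    simp
  -- first-order system in `t`
  have hy1 : ∀ t ∈ U, y₁ t = y₀ t + (-2*a)/okZ (-a) (b-1) (-b) y₀ t := by
    intro t ht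
    rw [hy₁def t ht, okK]
    congr 2
    ring
  have hne1 : ∀ t ∈ U, y₀ t - y₁ t ≠ 0 := by
    intro t ht
    rw [hy1 t ht]
    have : y₀ t - (y₀ t + (-2*a)/okZ (-a) (b-1) (-b) y₀ t)
      = 2*a/okZ (-a) (b-1) (-b) y₀ t := by ring
    rw [this]
    exact div_ne_zero (mul_ne_zero two_ne_zero ha) (hZ t ht)
  have hZeq : ∀ t ∈ U, okZ (-a) (b-1) (-b) y₀ t = 2*a/(y₀ t - y₁ t) := by
    intro t ht
    rw [eq_div_iff (hne1 t ht), hy1 t ht]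
    have := hZ t ht
    field_simp
    ring
  have hy0d : ∀ t ∈ U, HasDerivAt y₀ ((y₀ t*(y₀ t-1)*(y₀ t-t)*okZ (-a) (b-1) (-b) y₀ t
      - (a*(y₀ t-1)*(y₀ t-t) + (-(b-1))*y₀ t*(y₀ t-t) + (b-1)*y₀ t*(y₀ t-1)))/(t*(t-1))) t := by
    intro t ht
    obtain ⟨k, k', k0, k1, k2⟩ := hne t ht
    refine hda_congr ((hd t ht).1.hasDerivAt) ?_
    rw [← okZ_first a b y₀ t k0 (sub_ne_zero.2 k1) (sub_ne_zero.2 k2)]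
    have := sub_ne_zero.2 k'
    field_simp
  have hy1d : ∀ t ∈ U, HasDerivAt y₁ (y₁ t/(t*(t-1)) *
      (2*a*(y₁ t-1)*(y₁ t-t)/(y₀ t-y₁ t) + (a+b-1)*(y₁ t-t) + (a-b+1)*(y₁ t-1))) t := by
    intro t ht
    obtain ⟨k, k', k0, k1, k2⟩ := hne t ht
    have h1 := hy0d t ht
    have h2 := okZ_hasDerivAt a b U y₀ hy₀ t ht
    have h3 := h1.add ((h2.inv (hZ t ht)).const_mul (-2*a))
    have h4 : y₁ =ᶠ[nhds t] (fun s => y₀ s + (-2*a) * (okZ (-a) (b-1) (-b) y₀ s)⁻¹) := by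
      filter_upwards [hU.mem_nhds ht] with s hs
      rw [hy1 s hs]; ring
    have h5 := HasDerivAt.congr_of_eventuallyEq h3 h4
    rw [← y1_alg a b t (y₀ t) _ _ _ (y₁ t) ha (hZ t ht) k (sub_ne_zero.2 k') rfl rfl (hy1 t ht)]
    refine hda_congr (h5) ?_
    ring
  -- the system in `τ`
  have hu : ∀ τ ∈ V, HasDerivAt (fun s => y₀ (s^2)) (2/(τ*(τ^2-1)) *
      (2*a*y₀ (τ^2)*(y₀ (τ^2)-1)*(y₀ (τ^2)-τ^2)/(y₀ (τ^2)-(η τ)^2)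
        - a*(y₀ (τ^2)-1)*(y₀ (τ^2)-τ^2) + (b-1)*y₀ (τ^2)*(1-τ^2))) τ := by
    intro τ hτ
    obtain ⟨hτU, n0, n1, n2⟩ := hV τ hτ
    have h1 := hy0d _ hτU
    have h2 : HasDerivAt (fun s : ℂ => s^2) (2*τ) τ := by simpa using hasDerivAt_pow 2 τ
    have h3 := HasDerivAt.comp τ h1 h2
    refine hda_congr (h3) ?_
    rw [hZeq _ hτU, hη τ hτ]
    have m1 := hne1 _ hτU
    have m2 : τ^2 - 1 ≠ 0 := sub_ne_zero.2 (hne _ hτU).2.1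
    field_simp
    ring
  have hsq : ∀ τ ∈ V, τ^2 - 1 ≠ 0 := fun τ hτ => sub_ne_zero.2 (hne _ (hV τ hτ).1).2.1
  have hue : ∀ τ ∈ V, y₀ (τ^2) - (η τ)^2 ≠ 0 := by
    intro τ hτ
    rw [hη τ hτ]
    exact hne1 _ (hV τ hτ).1
  have heta0 : ∀ τ ∈ V, deriv η τ = etaRHS a b τ (y₀ (τ^2)) (η τ) := by
    apply eta_limit V hVopen η (fun τ => etaRHS a b τ (y₀ (τ^2)) (η τ)) hηdiff
    · intro τ hτ
      have c1 := (hu τ hτ).continuousAt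
      have c2 := (hηdiff τ hτ).continuousAt
      have c3 := mul_ne_zero (hV τ hτ).2.1 (hsq τ hτ)
      have c4 := hue τ hτ
      have key : ∀ u : ℂ → ℂ, ContinuousAt u τ → u τ - (η τ)^2 ≠ 0 →
          ContinuousAt (fun τ => etaRHS a b τ (u τ) (η τ)) τ := by
        intro u d1 d2
        unfold etaRHS
        fun_prop (disch := assumption)
      exact key (fun s => y₀ (s^2)) c1 c4
    · intro τ hτ h0
      simp [etaRHS, h0]
    · intro τ hτ
      obtain ⟨hτU, n0, n1, n2⟩ := hV τ hτ
      have h1 := hy1d _ hτU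
      have h2 : HasDerivAt (fun s : ℂ => s^2) (2*τ) τ := by simpa using hasDerivAt_pow 2 τ
      have h3 := HasDerivAt.comp τ h1 h2
      have h4 := (hηdiff τ hτ).hasDerivAt.pow 2
      have h5 : (η ^ 2) =ᶠ[nhds τ] (y₁ ∘ fun s : ℂ => s^2) := by
        filter_upwards [hVopen.mem_nhds hτ] with s hs
        exact hη s hs
      have h6 := h4.unique (h3.congr_of_eventuallyEq h5)
      rw [← hη τ hτ] at h6
      have m1 := hue τ hτ
      have m2 := hsq τ hτ
      have h7 : η τ * deriv η τ = (1/2) * (((2:ℕ):ℂ) * η τ ^ (2-1) * deriv η τ) := by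
        norm_num
        ring
      rw [h7, h6, etaRHS]
      field_simp
  have hη' : ∀ τ ∈ V, HasDerivAt η (etaRHS a b τ (y₀ (τ^2)) (η τ)) τ := by
    intro τ hτ
    rw [← heta0 τ hτ]
    exact (hηdiff τ hτ).hasDerivAt
  have he1 : ∀ τ ∈ V, η τ + 1 ≠ 0 := by
    intro τ hτ h
    apply (havoid τ hτ).2.2.1
    rw [hYeq τ hτ, h]
    simp
  have hm1 : ∀ τ ∈ V, τ - 1 ≠ 0 := fun τ hτ => sub_ne_zero.2 (hV τ hτ).2.2.1
  have hp1 : ∀ τ ∈ V, τ + 1 ≠ 0 := fun τ hτ h => (hV τ hτ).2.2.2 (eq_neg_of_add_eq_zero_left h)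
  -- the independent variable and the momentum
  have hT' : ∀ τ ∈ V, HasDerivAt (fun s : ℂ => (s+1)^2/(s-1)^2)
      (-4*(τ+1)/(τ-1)^3) τ := by
    intro τ hτ
    have hid := hasDerivAt_id' τ
    have m := hm1 τ hτ
    have h1 := ((hid.add_const (1:ℂ)).pow 2).div ((hid.sub_const (1:ℂ)).pow 2)
      (pow_ne_zero 2 m)
    refine hda_congr (h1) ?_
    try simp only [Pi.pow_apply]
    field_simp
    ring
  obtain ⟨M, hMdef⟩ : ∃ M : ℂ → ℂ, ∀ s, M s =
      -((s-1)*(η s-1)*(a*η s*(y₀ (s^2)-1) - (b-1)*(y₀ (s^2)-(η s)^2))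
        /((s+1)*(η s+1)*(y₀ (s^2)-(η s)^2))) := ⟨_, fun _ => rfl⟩
  have hDd : ∀ τ ∈ V, ∀ u', HasDerivAt (fun s => y₀ (s^2)) u' τ → ∀ e', HasDerivAt η e' τ →
      HasDerivAt (fun s => a*η s*(y₀ (s^2)-1) - (b-1)*(y₀ (s^2)-(η s)^2))
      (a*e'*(y₀ (τ^2)-1) + a*η τ*u' - (b-1)*(u'-2*η τ*e')) τ := by
    intro τ hτ u' hu e' he
    have h := ((he.const_mul a).mul (hu.sub_const 1)).sub
      ((hu.sub (he.pow 2)).const_mul (b-1))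
    refine hda_congr (h) ?_
    norm_num
  have hTT : ∀ τ ∈ V, (-4*(τ+1)/(τ-1)^3) = (-(τ-1)/(τ*(τ+1))) *
      ((τ+1)^2/(τ-1)^2 * ((τ+1)^2/(τ-1)^2 - 1)) := by
    intro τ hτ
    have := hm1 τ hτ
    have := hp1 τ hτ
    have := (hV τ hτ).2.1
    field_simp
    ring
  have hTne : ∀ τ ∈ V, (-4*(τ+1)/(τ-1)^3) ≠ 0 := fun τ hτ =>
    div_ne_zero (mul_ne_zero (by norm_num) (hp1 τ hτ)) (pow_ne_zero 3 (hm1 τ hτ))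
  have hY1 : ∀ τ ∈ V, ∀ T Y, T = (τ+1)^2/(τ-1)^2 → Y = Y₀ T →
      T*(T-1)*deriv Y₀ T =
      Y*(Y-1)*(Y-T)*M τ - (a*(Y-1)*(Y-T) + (1/2)*Y*(Y-T) + (-1/2)*Y*(Y-1)) := by
    intro τ hτ T Y hT hY
    have hYv := hYeq τ hτ
    rw [← hT, ← hY] at hYv
    have hW := hWsub τ hτ
    rw [← hT] at hW
    have q1 := (hYdiff T hW).1.hasDerivAt
    rw [hT] at q1
    have q2 := HasDerivAt.comp τ q1 (hT' τ hτ)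
    have hu' := hu τ hτ
    have he' := hη' τ hτ
    have hD := hDd τ hτ _ hu' _ he'
    have hid := hasDerivAt_id' τ
    have q3 := ((((hid.add_const (1:ℂ)).const_mul a).mul (he'.add_const 1)).mul (hu'.add he')).div
      ((hid.sub_const (1:ℂ)).mul hD) (mul_ne_zero (hm1 τ hτ) (hden τ hτ))
    have hE : (Y₀ ∘ fun s : ℂ => (s+1)^2/(s-1)^2) =ᶠ[nhds τ]
        (fun s => a*(s+1)*(η s+1)*(y₀ (s^2)+η s) /
        ((s-1)*(a*η s*(y₀ (s^2)-1) - (b-1)*(y₀ (s^2)-(η s)^2)))) := by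
      filter_upwards [hVopen.mem_nhds hτ] with s hs
      exact hYeq s hs
    have q4 := q2.unique (HasDerivAt.congr_of_eventuallyEq q3 hE)
    have q5 := flow_Y a b τ (y₀ (τ^2)) (η τ) _ _ _ T Y (M τ) (hV τ hτ).2.1 (hm1 τ hτ) (hp1 τ hτ)
      (hden τ hτ) (hue τ hτ) (he1 τ hτ) rfl rfl rfl hT hYv (hMdef τ)
    rw [← hT, hTT τ hτ, ← hT] at q4
    have hc : (-(τ-1)/(τ*(τ+1))) ≠ 0 := div_ne_zero (neg_ne_zero.2 (hm1 τ hτ))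
      (mul_ne_zero (hV τ hτ).2.1 (hp1 τ hτ))
    apply mul_right_cancel₀ hc
    rw [← q5]
    simp only [Pi.add_apply, Pi.mul_apply] at q4
    unfold etaRHS at q4
    linear_combination q4
  have hM' : ∀ τ ∈ V, ∀ T Y, T = (τ+1)^2/(τ-1)^2 → Y = Y₀ T → HasDerivAt M
      (-((3*Y^2-2*(1+T)*Y+T)*(M τ)^2/2
      - (a*(2*Y-1-T)+(1/2)*(2*Y-T)+(-1/2)*(2*Y-1))*M τ + ((a+1/2+-1/2)^2-(b-1)^2)/2)
      * (-(τ-1)/(τ*(τ+1)))) τ := by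
    intro τ hτ T Y hT hY
    have hYv := hYeq τ hτ
    rw [← hT, ← hY] at hYv
    have hu' := hu τ hτ
    have he' := hη' τ hτ
    have hD := hDd τ hτ _ hu' _ he'
    have hid := hasDerivAt_id' τ
    have q3 := ((((hid.sub_const (1:ℂ))).mul (he'.sub_const 1)).mul hD).div
      (((hid.add_const (1:ℂ)).mul (he'.add_const 1)).mul (hu'.sub (he'.pow 2)))
      (mul_ne_zero (mul_ne_zero (hp1 τ hτ) (he1 τ hτ)) (hue τ hτ))
    have q6 : HasDerivAt M _ τ := q3.neg.congr_of_eventuallyEq (Filter.Eventually.of_forall hMdef)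
    rw [← flow_M a b τ (y₀ (τ^2)) (η τ) _ _ _ T Y (M τ) (hV τ hτ).2.1 (hm1 τ hτ) (hp1 τ hτ)
      (hden τ hτ) (hue τ hτ) (he1 τ hτ) rfl rfl rfl hT hYv (hMdef τ)]
    refine hda_congr (q6) ?_
    try simp only [Pi.sub_apply, Pi.mul_apply, Pi.pow_apply]
    unfold etaRHS
    push_cast
    ring
  -- conclusion
  obtain ⟨T, hT⟩ : ∃ T, T = (τ₀+1)^2/(τ₀-1)^2 := ⟨_, rfl⟩
  have hav := havoid τ₀ hτ₀
  have hW := hWsub τ₀ hτ₀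
  have hTd := hT' τ₀ hτ₀
  rw [← hT] at hav hW ⊢
  obtain ⟨t0, t1, k0, k1, k2⟩ := hav
  have t1' := sub_ne_zero.2 t1
  have k1' := sub_ne_zero.2 k1
  have k2' := sub_ne_zero.2 k2
  have q1 := (hYdiff T hW).1.hasDerivAt
  have q2 := (hYdiff T hW).2.hasDerivAt
  have hq1 := hY1 τ₀ hτ₀ T _ hT rfl
  have hfirst : deriv Y₀ T = _ / (T*(T-1)) :=
    (eq_div_iff (mul_ne_zero t0 t1')).2 ((mul_comm _ _).trans hq1)
  have hham := ham_id T (Y₀ T) (M τ₀) a (1/2) (-1/2) (b-1) (deriv Y₀ T) _ t0 t1' k0 k1' k2'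
    (by rw [hfirst]) rfl
  have hMd := hM' τ₀ hτ₀ T _ hT rfl
  obtain ⟨tt, htt⟩ : ∃ tt : ℂ → ℂ, tt = fun s : ℂ => (s+1)^2/(s-1)^2 := ⟨_, rfl⟩
  have htt0 : tt τ₀ = T := by rw [htt, hT]
  rw [← htt] at hTd
  have p1 : HasDerivAt (fun s => Y₀ (tt s)) (deriv Y₀ T * (-4*(τ₀+1)/(τ₀-1)^3)) τ₀ :=
    HasDerivAt.comp τ₀ (by rw [htt0]; exact q1) hTd
  have p2 : HasDerivAt (fun s => deriv Y₀ (tt s))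
      (deriv (deriv Y₀) T * (-4*(τ₀+1)/(τ₀-1)^3)) τ₀ :=
    HasDerivAt.comp τ₀ (h₂ := deriv Y₀) (by rw [htt0]; exact q2) hTd
  have hL := (hTd.mul (hTd.sub_const 1)).mul p2
  have hR := (((p1.mul (p1.sub_const 1)).mul (p1.sub hTd)).mul hMd).sub
      (((((p1.sub_const 1).const_mul a).mul (p1.sub hTd)).add
        ((p1.const_mul (1/2)).mul (p1.sub hTd))).add
        ((p1.const_mul (-1/2)).mul (p1.sub_const 1)))
  have hE : (fun s => tt s * (tt s - 1) * deriv Y₀ (tt s)) =ᶠ[nhds τ₀]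
      (fun s => Y₀ (tt s)*(Y₀ (tt s)-1)*(Y₀ (tt s)-tt s)*M s - (a*(Y₀ (tt s)-1)*(Y₀ (tt s)-tt s)
        + (1/2)*Y₀ (tt s)*(Y₀ (tt s)-tt s) + (-1/2)*Y₀ (tt s)*(Y₀ (tt s)-1))) := by
    filter_upwards [hVopen.mem_nhds hτ₀] with s hs
    exact hY1 s hs (tt s) _ (by rw [htt]) rfl
  have hfin := HasDerivAt.unique hL (HasDerivAt.congr_of_eventuallyEq hR hE)
  simp only [Pi.sub_apply, Pi.mul_apply, htt0] at hfin
  have hTn := hTne τ₀ hτ₀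
  have hTT0 := hTT τ₀ hτ₀
  rw [← hT] at hTT0
  have hκ : (-(τ₀-1)/(τ₀*(τ₀+1))) = (-4*(τ₀+1)/(τ₀-1)^3) / (T*(T-1)) := by
    rw [hTT0]
    field_simp
  rw [hκ] at hfin
  generalize (-4*(τ₀+1)/(τ₀-1)^3) = dT at hfin hTn
  unfold PVIAt pviRHS
  rw [show ((1:ℂ) - (1/2)^2) = 1 - (-1/2+1)^2 by norm_num]
  apply mul_left_cancel₀ (mul_ne_zero (mul_ne_zero t0 t1') hTn)
  linear_combination hfin - dT * hham
end

section
/- Let a, b ∈ ℂ. Suppose g₀ is a solution of P_VI(a, a, b, b; t₂) on an open set U ⊆ ℂ, and let g₁ = K_{[−a, −a, −b, b; t₂]} g₀ (assumed defined on U). Let r, ρ : U → ℂ be differentiable functions with r(t₂)² = t₂² − t₂, r(t₂) ≠ 0, and ρ(t₂)² = g₁(t₂)² − g₁(t₂) for all t₂ ∈ U. Define T₂(t₂) = 1/2 + (t₂ − 1/2)/(2 r(t₂)), and assume the derivative of T₂ is nonzero on U and that a·ρ(t₂) − (b−1)(g₀(t₂) − g₁(t₂)) ≠ 0 on U. Suppose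 G₀ is twice differentiable on a neighbourhood of T₂(U), satisfies G₀(T₂(t₂)) = 1/2 + (t₂ − g₁ + ρ)/(2r) + ((a−b+1)(g₀−g₁)(g₁ − 1/2 − ρ)) / (2(aρ − (b−1)(g₀−g₁)) r) for all t₂ ∈ U (all functions evaluated at t₂), and avoids 0, 1 and its argument on points T₂(t₂) ∉ {0,1}. Then G₀ satisfies P_VI(1/2, 1/2, a, b; T₂) at every point T₂(t₂), t₂ ∈ U. -/
set_option maxHeartbeats 1000000

theorem pvi_of_system (ν0 ν1 νt νi t y d e z w : ℂ) (ht : t ≠ 0) (ht1 : t - 1 ≠ 0)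
    (hy : y ≠ 0) (hy1 : y - 1 ≠ 0) (hyt : y - t ≠ 0)
    (A : t*(t-1)*d = y*(y-1)*(y-t)*z + (ν0*((y-1)*(y-t)) + ν1*(y*(y-t)) + (νt+1)*(y*(y-1))))
    (B : (2*t-1)*d + t*(t-1)*e = ((3*y^2-2*(1+t)*y+t)*d - y*(y-1))*z + y*(y-1)*(y-t)*w
      + ((ν0*(2*y-1-t)+ν1*(2*y-t)+(νt+1)*(2*y-1))*d - ν0*(y-1) - ν1*y))
    (C : t*(t-1)*w = -((3*y^2-2*(1+t)*y+t)*z^2/2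
      + (ν0*(2*y-1-t)+ν1*(2*y-t)+(νt+1)*(2*y-1))*z + ((ν0+ν1+νt+1)^2-(νi-1)^2)/2)) :
    e = (1/2) * (1/y + 1/(y - 1) + 1/(y - t)) * d^2
    - (1/t + 1/(t-1) + 1/(y - t)) * d
    + (y * (y - 1) * (y - t) / (t^2 * (t-1)^2)) *
      ((νi - 1)^2/2 + (-(ν0^2/2)) * t/y^2 + (ν1^2/2) * (t-1)/(y - 1)^2
        + ((1 - νt^2)/2) * (t*(t-1))/(y - t)^2) := by
  have hd : d = (y*(y-1)*(y-t)*z + (ν0*((y-1)*(y-t)) + ν1*(y*(y-t)) + (νt+1)*(y*(y-1))))/(t*(t-1)) := by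
    rw [← A]; field_simp
  have hw : w = -((3*y^2-2*(1+t)*y+t)*z^2/2
      + (ν0*(2*y-1-t)+ν1*(2*y-t)+(νt+1)*(2*y-1))*z + ((ν0+ν1+νt+1)^2-(νi-1)^2)/2)/(t*(t-1)) := by
    rw [← C]; field_simp
  have he : e = (((3*y^2-2*(1+t)*y+t)*d - y*(y-1))*z + y*(y-1)*(y-t)*w
      + ((ν0*(2*y-1-t)+ν1*(2*y-t)+(νt+1)*(2*y-1))*d - ν0*(y-1) - ν1*y) - (2*t-1)*d)/(t*(t-1)) := by
    rw [← B]; field_simp; ring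
  rw [he, hw, hd]
  field_simp
  ring

theorem system_of_pvi (ν0 ν1 νt νi t y d e z w : ℂ) (ht : t ≠ 0) (ht1 : t - 1 ≠ 0)
    (hy : y ≠ 0) (hy1 : y - 1 ≠ 0) (hyt : y - t ≠ 0)
    (A : t*(t-1)*d = y*(y-1)*(y-t)*z + (ν0*((y-1)*(y-t)) + ν1*(y*(y-t)) + (νt+1)*(y*(y-1))))
    (B : (2*t-1)*d + t*(t-1)*e = ((3*y^2-2*(1+t)*y+t)*d - y*(y-1))*z + y*(y-1)*(y-t)*w
      + ((ν0*(2*y-1-t)+ν1*(2*y-t)+(νt+1)*(2*y-1))*d - ν0*(y-1) - ν1*y))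
    (E : e = (1/2) * (1/y + 1/(y - 1) + 1/(y - t)) * d^2
    - (1/t + 1/(t-1) + 1/(y - t)) * d
    + (y * (y - 1) * (y - t) / (t^2 * (t-1)^2)) *
      ((νi - 1)^2/2 + (-(ν0^2/2)) * t/y^2 + (ν1^2/2) * (t-1)/(y - 1)^2
        + ((1 - νt^2)/2) * (t*(t-1))/(y - t)^2)) :
    t*(t-1)*w = -((3*y^2-2*(1+t)*y+t)*z^2/2
      + (ν0*(2*y-1-t)+ν1*(2*y-t)+(νt+1)*(2*y-1))*z + ((ν0+ν1+νt+1)^2-(νi-1)^2)/2) := by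
  set X := -((3*y^2-2*(1+t)*y+t)*z^2/2
      + (ν0*(2*y-1-t)+ν1*(2*y-t)+(νt+1)*(2*y-1))*z + ((ν0+ν1+νt+1)^2-(νi-1)^2)/2) with hX
  have key := pvi_of_system ν0 ν1 νt νi t y d
    ((((3*y^2-2*(1+t)*y+t)*d - y*(y-1))*z + y*(y-1)*(y-t)*(X/(t*(t-1)))
      + ((ν0*(2*y-1-t)+ν1*(2*y-t)+(νt+1)*(2*y-1))*d - ν0*(y-1) - ν1*y) - (2*t-1)*d)/(t*(t-1)))
    z (X/(t*(t-1))) ht ht1 hy hy1 hyt A (by field_simp; ring) (by rw [← hX]; field_simp)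
  rw [← E] at key
  have h2 : y*(y-1)*(y-t)*(t*(t-1)*w - X) = 0 := by
    rw [← key] at B
    field_simp at B
    linear_combination (-1)*B
  have h3 : y*(y-1)*(y-t) ≠ 0 := by positivity
  exact sub_eq_zero.mp ((mul_eq_zero.mp h2).resolve_left h3)

/-- Okamoto step. -/
theorem okamoto_step (a b t y d z w q qd : ℂ) (hz : z ≠ 0)
    (hq : q = y - 2*a/z) (hqd : qd = d + 2*a*w/z^2)
    (A : t*(t-1)*d = y*(y-1)*(y-t)*z + ((-a)*((y-1)*(y-t)) + (-a)*(y*(y-t)) + (-b+1)*(y*(y-1))))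
    (C : t*(t-1)*w = -((3*y^2-2*(1+t)*y+t)*z^2/2
      + ((-a)*(2*y-1-t)+(-a)*(2*y-t)+(-b+1)*(2*y-1))*z + ((-a+-a+-b+1)^2-(b-1)^2)/2)) :
    t*(t-1)*qd = q*(q-1)*((q-t)*z + (1+a-b)) ∧
    t*(t-1)*w = -((3*q^2-2*(1+t)*q+t)*z^2/2 + (1+a-b)*(2*q-1)*z + 2*a*(1-b)) := by
  have hy : y = q + 2*a/z := by rw [hq]; ring
  constructor
  · have : t*(t-1)*qd = t*(t-1)*d + 2*a*(t*(t-1)*w)/z^2 := by rw [hqd]; ring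
    rw [this, A, C, hy]
    field_simp
    ring
  · rw [C, hy]
    field_simp
    ring

/-- Quadratic step, rational parametrisation. -/
theorem quad_param (a b t r q ρ p rd qd ρd pd G T Gd P Pd v vd: ℂ) (hr0 : r ≠ 0)
    (hr : r^2 = t^2 - t) (hρ : ρ^2 = q^2 - q)
    (hrd : rd = (2*t-1)/(2*r))
    (hρd : ρd = (q-1/2)*ρ*((q-t)*p+(1+a-b))/(t*(t-1)))
    (hqd : t*(t-1)*qd = q*(q-1)*((q-t)*p + (1+a-b)))
    (hpd : t*(t-1)*pd = -((3*q^2-2*(1+t)*q+t)*p^2/2 + (1+a-b)*(2*q-1)*p + 2*a*(1-b)))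
    (hv : v = q - 1/2 - ρ) (hvd : vd = qd - ρd)
    (hden : p*ρ+2*(1-b) ≠ 0)
    (hT : T = 1/2 + (t-1/2)/(2*r))
    (hP : P = 4*r*(q-1/2+ρ)*(p*ρ+2*(1-b)))
    (hPd : Pd = 4*(rd*(q-1/2+ρ)*(p*ρ+2*(1-b)) + r*(qd+ρd)*(p*ρ+2*(1-b))
        + r*(q-1/2+ρ)*(pd*ρ+p*ρd)))
    (hG : G = T - v/(2*r) + (1+a-b)/P)
    (hGd : Gd = -1/(8*r^3) - (vd*r - v*rd)/(2*r^2) - (1+a-b)*Pd/P^2) :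
    -(r/2)*Gd = G*(G-1)*(G-T)*P + ((-(1/2))*((G-1)*(G-T)) + (-(1/2))*(G*(G-T)) + (-a+1)*(G*(G-1))) ∧
    -(r/2)*Pd = -((3*G^2-2*(1+T)*G+T)*P^2/2
      + ((-(1/2))*(2*G-1-T)+(-(1/2))*(2*G-T)+(-a+1)*(2*G-1))*P + ((-(1/2)+-(1/2)+-a+1)^2-(b-1)^2)/2) := by
  obtain ⟨s, hs⟩ : ∃ s, s = 2*(t-1/2+r) := ⟨_, rfl⟩
  obtain ⟨x, hx⟩ : ∃ x, x = 2*(q-1/2+ρ) := ⟨_, rfl⟩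
  have hss : s * (2*(t-1/2-r)) = 1 := by rw [hs]; linear_combination (-4)*hr
  have hxx : x * (2*(q-1/2-ρ)) = 1 := by rw [hx]; linear_combination (-4)*hρ
  have hs0 : s ≠ 0 := left_ne_zero_of_mul_eq_one hss
  have hx0 : x ≠ 0 := left_ne_zero_of_mul_eq_one hxx
  have hsi : 2*(t-1/2-r) = 1/s := by field_simp; linear_combination hss
  have hxi : 2*(q-1/2-ρ) = 1/x := by field_simp; linear_combination hxx
  have et : t = 1/2 + (s+1/s)/4 := by rw [← hsi, hs]; ring
  have er : r = (s-1/s)/4 := by rw [← hsi, hs]; ring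
  have eq : q = 1/2 + (x+1/x)/4 := by rw [← hxi, hx]; ring
  have eρ : ρ = (x-1/x)/4 := by rw [← hxi, hx]; ring
  have htt : t*(t-1) = r^2 := by rw [hr]; ring
  have hs1 : s^2 - 1 ≠ 0 := by
    intro h; apply hr0; rw [er]; field_simp; rw [h]; simp
  have hqd' : qd = q*(q-1)*((q-t)*p + (1+a-b))/r^2 := by rw [← hqd, htt]; field_simp
  have hpd' : pd = -((3*q^2-2*(1+t)*q+t)*p^2/2 + (1+a-b)*(2*q-1)*p + 2*a*(1-b))/r^2 := by
    rw [← hpd, htt]; field_simp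
  rw [htt] at hρd
  obtain ⟨n, hn⟩ : ∃ n, n = p*(x^2-1)+8*(1-b)*x := ⟨_, rfl⟩
  have hnm : 4*x*(p*ρ+2*(1-b)) = n := by rw [eρ, hn]; field_simp; ring
  have hn0 : n ≠ 0 := by rw [← hnm]; exact mul_ne_zero (mul_ne_zero (by norm_num) hx0) hden
  have eP : P = (s^2-1)*n/(8*s) := by
    rw [hP, er, eq, eρ, hn]; field_simp; ring
  have eT : T = s^2/(s^2-1) := by
    rw [hT, er, et]; field_simp; ring
  have ev : v = 1/(2*x) := by rw [hv, eq, eρ]; field_simp; ring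
  have eG : G = (s^2 - s/x + 8*(1+a-b)*s/n)/(s^2-1) := by
    rw [hG, eT, ev, er, eP]; field_simp; ring
  have erd : rd = (s^2+1)/(s^2-1) := by
    rw [hrd, et, er]; field_simp; ring
  have eqd : qd = (x-1/x)^2/(s-1/s)^2*(((x+1/x-s-1/s)/4)*p + (1+a-b)) := by
    rw [hqd', er, eq, et]; field_simp; ring
  have eρd : ρd = (x+1/x)*(x-1/x)/(s-1/s)^2*(((x+1/x-s-1/s)/4)*p + (1+a-b)) := by
    rw [hρd, er, eq, eρ, et]; field_simp; ring
  have evd : vd = -(x-1/x)/x*2/(s-1/s)^2*(((x+1/x-s-1/s)/4)*p + (1+a-b)) := by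
    rw [hvd, eqd, eρd]; field_simp; ring
  have h2 : -(r/2)*Pd = -((3*G^2-2*(1+T)*G+T)*P^2/2
      + ((-(1/2))*(2*G-1-T)+(-(1/2))*(2*G-T)+(-a+1)*(2*G-1))*P + ((-(1/2)+-(1/2)+-a+1)^2-(b-1)^2)/2) := by
    rw [hPd, eP, eG, eT, eqd, eρd, hpd', erd, er, eq, eρ, et]
    field_simp
    rw [hn]
    ring
  refine ⟨?_, h2⟩
  have h3 : -(r/2)*Gd = -(r/2)*(-1/(8*r^3) - (vd*r - v*rd)/(2*r^2)) - (1+a-b)/P^2*(-(r/2)*Pd) := by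
    rw [hGd]; ring
  rw [h3, h2, eP, eG, eT, evd, ev, erd, er]
  field_simp
  rw [hn]
  ring

/-- Theorem 2 of Vidunas–Kitaev: the quadratic transformation
`(a,a,b,b) ↦ (1/2,1/2,a,b)`. -/
theorem quadratic_transformation_kitaev_symmetric
    (a b : ℂ) (U : Set ℂ) (g₀ : ℂ → ℂ)
    (hg₀ : IsPVISolutionOn a a b b g₀ U)
    (hZ : ∀ t ∈ U, okZ (-a) (-a) (-b) g₀ t ≠ 0)
    (g₁ : ℂ → ℂ) (hg₁def : ∀ t ∈ U, g₁ t = okK (-a) (-a) (-b) b g₀ t)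
    (r ρ : ℂ → ℂ)
    (hrdiff : ∀ t ∈ U, DifferentiableAt ℂ r t)
    (hρdiff : ∀ t ∈ U, DifferentiableAt ℂ ρ t)
    (hr : ∀ t ∈ U, (r t)^2 = t^2 - t ∧ r t ≠ 0)
    (hρ : ∀ t ∈ U, (ρ t)^2 = (g₁ t)^2 - g₁ t)
    (T₂ : ℂ → ℂ) (hT₂def : ∀ t, T₂ t = 1/2 + (t - 1/2)/(2 * r t))
    (hT₂' : ∀ t ∈ U, deriv T₂ t ≠ 0)
    (hden : ∀ t ∈ U, a * ρ t - (b-1)*(g₀ t - g₁ t) ≠ 0)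
    (G₀ : ℂ → ℂ) (W : Set ℂ) (hWopen : IsOpen W) (hWsub : ∀ t ∈ U, T₂ t ∈ W)
    (hGdiff : ∀ T ∈ W, DifferentiableAt ℂ G₀ T ∧ DifferentiableAt ℂ (deriv G₀) T)
    (hGeq : ∀ t ∈ U, G₀ (T₂ t) = 1/2 + (t - g₁ t + ρ t)/(2 * r t)
      + ((a-b+1)*(g₀ t - g₁ t)*(g₁ t - 1/2 - ρ t)) /
          (2*(a * ρ t - (b-1)*(g₀ t - g₁ t)) * r t))
    (havoid : ∀ t ∈ U, T₂ t ≠ 0 ∧ T₂ t ≠ 1 ∧ G₀ (T₂ t) ≠ 0 ∧ G₀ (T₂ t) ≠ 1 ∧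
      G₀ (T₂ t) ≠ T₂ t) :
    ∀ t ∈ U, PVIAt (1/2) (1/2) a b G₀ (T₂ t) := by
  obtain ⟨hU, hne, hdiff, hpvi⟩ := hg₀
  intro t₀ ht₀
  have ha : a ≠ 0 := by
    intro h
    apply hden t₀ ht₀
    rw [hg₁def t₀ ht₀, okK, h]
    simp
  -- the momentum
  obtain ⟨Z, hZdef⟩ : ∃ Z : ℂ → ℂ, Z = okZ (-a) (-a) (-b) g₀ := ⟨_, rfl⟩
  rw [← hZdef] at hZ
  have hZdiff : ∀ t ∈ U, DifferentiableAt ℂ Z t := by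
    intro t ht
    obtain ⟨h0, h1, hy, hy1, hyt⟩ := hne t ht
    obtain ⟨d1, d2⟩ := hdiff t ht
    have : Z = fun t => ((t-1) * deriv g₀ t - (-a)) / (g₀ t)
      - (t * deriv g₀ t + (-a)) / (g₀ t - 1)
      + (deriv g₀ t - 1 - (-b)) / (g₀ t - t) := by rw [hZdef]; rfl
    rw [this]
    have e1 := sub_ne_zero.mpr hy1
    have e2 := sub_ne_zero.mpr hyt
    fun_prop (disch := assumption)
  have hA : ∀ t ∈ U, t*(t-1)*deriv g₀ t = g₀ t*(g₀ t-1)*(g₀ t-t)*Z t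
      + ((-a)*((g₀ t-1)*(g₀ t-t)) + (-a)*(g₀ t*(g₀ t-t)) + (-b+1)*(g₀ t*(g₀ t-1))) := by
    intro t ht
    obtain ⟨h0, h1, hy, hy1, hyt⟩ := hne t ht
    have e1 := sub_ne_zero.mpr hy1
    have e2 := sub_ne_zero.mpr hyt
    rw [hZdef, okZ]
    field_simp
    ring
  have hC : ∀ t ∈ U, t*(t-1)*deriv Z t = -((3*g₀ t^2-2*(1+t)*g₀ t+t)*Z t^2/2
      + ((-a)*(2*g₀ t-1-t)+(-a)*(2*g₀ t-t)+(-b+1)*(2*g₀ t-1))*Z t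
      + ((-a+-a+-b+1)^2-(b-1)^2)/2) := by
    intro t ht
    obtain ⟨h0, h1, hy, hy1, hyt⟩ := hne t ht
    have e0 := sub_ne_zero.mpr h1
    have e1 := sub_ne_zero.mpr hy1
    have e2 := sub_ne_zero.mpr hyt
    obtain ⟨d1, d2⟩ := hdiff t ht
    have D1 := d1.hasDerivAt
    have D2 := d2.hasDerivAt
    have DZ := (hZdiff t ht).hasDerivAt
    have I := hasDerivAt_id' t
    have hL := ((I.mul (I.sub_const 1)).mul D2)
    have hR := (((D1.mul (D1.sub_const 1)).mul (D1.sub I)).mul DZ).add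
      (((((D1.sub_const 1).mul (D1.sub I)).const_mul (-a)).add
        ((D1.mul (D1.sub I)).const_mul (-a))).add ((D1.mul (D1.sub_const 1)).const_mul (-b+1)))
    have hB := (hL.congr_of_eventuallyEq (Filter.eventuallyEq_of_mem (hU.mem_nhds ht)
      (fun u hu => (hA u hu).symm))).unique hR
    have hE := hpvi t ht
    rw [PVIAt, pviRHS] at hE
    refine system_of_pvi (-a) (-a) (-b) b t (g₀ t) (deriv g₀ t) (deriv (deriv g₀) t) (Z t)
      (deriv Z t) h0 e0 hy e1 e2 (hA t ht) ?_ (by rw [hE]; ring)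
    simp at hB
    linear_combination hB
  -- the transformed function
  have hq : ∀ t ∈ U, g₁ t = g₀ t - 2*a/Z t := by
    intro t ht
    rw [hg₁def t ht, okK, ← hZdef]
    ring
  have hqder : ∀ t ∈ U, HasDerivAt g₁ (deriv g₀ t + 2*a*deriv Z t/Z t^2) t := by
    intro t ht
    have h := (hdiff t ht).1.hasDerivAt.sub
      (((hasDerivAt_const t (2*a)).div (hZdiff t ht).hasDerivAt (hZ t ht)))
    refine (h.congr_of_eventuallyEq (Filter.eventuallyEq_of_mem (hU.mem_nhds ht)
      (fun u hu => hq u hu))).congr_deriv ?_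
    ring
  have hsys : ∀ t ∈ U, t*(t-1)*deriv g₁ t = g₁ t*(g₁ t-1)*((g₁ t-t)*Z t + (1+a-b)) ∧
      t*(t-1)*deriv Z t = -((3*g₁ t^2-2*(1+t)*g₁ t+t)*Z t^2/2 + (1+a-b)*(2*g₁ t-1)*Z t
        + 2*a*(1-b)) := by
    intro t ht
    exact okamoto_step a b t (g₀ t) (deriv g₀ t) (Z t) (deriv Z t) (g₁ t) (deriv g₁ t) (hZ t ht)
      (hq t ht) (hqder t ht).deriv (hA t ht) (hC t ht)
  have hqdiff : ∀ t ∈ U, DifferentiableAt ℂ g₁ t := fun t ht => (hqder t ht).differentiableAt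
  -- derivative of r
  have hrd : ∀ t ∈ U, deriv r t = (2*t-1)/(2*r t) := by
    intro t ht
    have h1 := (hrdiff t ht).hasDerivAt.pow 2
    have I := hasDerivAt_id' t
    have h2 := (I.pow 2).sub I
    have h3 := (h1.congr_of_eventuallyEq (Filter.eventuallyEq_of_mem (hU.mem_nhds ht)
      (fun u hu => (hr u hu).1.symm))).unique h2
    have h0 := (hr t ht).2
    simp at h3
    field_simp
    linear_combination h3
  -- derivative of rho
  have hρ1 : ∀ t ∈ U, 2*ρ t*deriv ρ t
      = ρ t^2*((2*g₁ t-1)*((g₁ t-t)*Z t+(1+a-b))/(t*(t-1))) := by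
    intro t ht
    obtain ⟨h0, h1, -⟩ := hne t ht
    have e0 := sub_ne_zero.mpr h1
    have D := (hqdiff t ht).hasDerivAt
    have h1 := (hρdiff t ht).hasDerivAt.pow 2
    have h2 := (D.pow 2).sub D
    have h3 := (h1.congr_of_eventuallyEq (Filter.eventuallyEq_of_mem (hU.mem_nhds ht)
      (fun u hu => (hρ u hu).symm))).unique h2
    simp at h3
    have h4 := (hsys t ht).1
    rw [hρ t ht]
    field_simp
    linear_combination (t*(t-1))*h3 + (2*g₁ t-1)*h4
  have hρd : ∀ t ∈ U, deriv ρ t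
      = (g₁ t-1/2)*ρ t*((g₁ t-t)*Z t+(1+a-b))/(t*(t-1)) := by
    intro t ht
    obtain ⟨h0, h1, -⟩ := hne t ht
    have e0 := sub_ne_zero.mpr h1
    by_cases hz : ρ t = 0
    · have hdd : DifferentiableAt ℂ (deriv ρ) t := by
        have : DifferentiableOn ℂ ρ U := fun u hu => (hρdiff u hu).differentiableWithinAt
        exact (this.deriv hU).differentiableAt (hU.mem_nhds ht)
      have hN : DifferentiableAt ℂ
          (fun t => (2*g₁ t-1)*((g₁ t-t)*Z t+(1+a-b))/(t*(t-1))) t := by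
        have := hqdiff t ht
        have := hZdiff t ht
        have := mul_ne_zero h0 e0
        fun_prop (disch := assumption)
      have D := (hρdiff t ht).hasDerivAt
      have hL := (D.const_mul 2).mul hdd.hasDerivAt
      have hR := (D.pow 2).mul hN.hasDerivAt
      have h3 := (hL.congr_of_eventuallyEq (Filter.eventuallyEq_of_mem (hU.mem_nhds ht)
        (fun u hu => (hρ1 u hu).symm))).unique hR
      simp [hz] at h3
      rw [h3, hz]
      simp
    · apply mul_left_cancel₀ (mul_ne_zero two_ne_zero hz)
      rw [hρ1 t ht]
      ring
  -- derivative of T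
  have hT : ∀ t ∈ U, HasDerivAt T₂ (-1/(8*r t^3)) t := by
    intro t ht
    have h0 := (hr t ht).2
    have h1 := (hrdiff t ht).hasDerivAt
    rw [hrd t ht] at h1
    have h2 := (((hasDerivAt_id' t).sub_const (1/2)).div (h1.const_mul 2)
      (mul_ne_zero two_ne_zero h0)).const_add (1/2)
    have : T₂ = fun t => 1/2 + (t - 1/2)/(2 * r t) := funext hT₂def
    rw [this]
    refine h2.congr_deriv ?_
    field_simp
    linear_combination 32*(hr t ht).1
  have hTT : ∀ t ∈ U, T₂ t * (T₂ t - 1) = 1/(16*r t^2) := by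
    intro t ht
    have h0 := (hr t ht).2
    rw [hT₂def]
    field_simp
    linear_combination (-64)*(hr t ht).1
  -- new momentum
  obtain ⟨P, hP⟩ : ∃ P : ℂ → ℂ, P = fun t => 4*r t*(g₁ t-1/2+ρ t)*(Z t*ρ t+2*(1-b)) := ⟨_, rfl⟩
  have hPd : ∀ t ∈ U, HasDerivAt P (4*(deriv r t*(g₁ t-1/2+ρ t)*(Z t*ρ t+2*(1-b))
      + r t*(deriv g₁ t+deriv ρ t)*(Z t*ρ t+2*(1-b))
        + r t*(g₁ t-1/2+ρ t)*(deriv Z t*ρ t+Z t*deriv ρ t))) t := by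
    intro t ht
    have Dρ := (hρdiff t ht).hasDerivAt
    have h := ((((hrdiff t ht).hasDerivAt.const_mul 4).mul
      (((hqdiff t ht).hasDerivAt.sub_const (1/2)).add Dρ))).mul
      (((hZdiff t ht).hasDerivAt.mul Dρ).add_const (2*(1-b)))
    rw [hP]
    refine h.congr_deriv ?_
    simp
    ring
  have hden' : ∀ t ∈ U, Z t*ρ t+2*(1-b) ≠ 0 := by
    intro t ht h
    apply hden t ht
    rw [hq t ht]
    have := hZ t ht
    field_simp
    linear_combination a*h
  have huv : ∀ t ∈ U, (g₁ t-1/2+ρ t)*(g₁ t-1/2-ρ t) = 1/4 := by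
    intro t ht
    linear_combination (-1)*hρ t ht
  have hP0 : ∀ t ∈ U, P t ≠ 0 := by
    intro t ht
    have hu : g₁ t-1/2+ρ t ≠ 0 := left_ne_zero_of_mul (b := g₁ t-1/2-ρ t) (by
      rw [huv t ht]; norm_num)
    rw [hP]
    exact mul_ne_zero (mul_ne_zero (mul_ne_zero (by norm_num) (hr t ht).2) hu) (hden' t ht)
  have hG : ∀ t ∈ U, G₀ (T₂ t) = T₂ t - (g₁ t - 1/2 - ρ t)/(2*r t) + (1+a-b)/P t := by
    intro t ht
    have hz := hZ t ht
    have hr0 := (hr t ht).2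
    have hm := hden' t ht
    have hu : g₁ t-1/2+ρ t ≠ 0 := left_ne_zero_of_mul (b := g₁ t-1/2-ρ t) (by
      rw [huv t ht]; norm_num)
    have h1 : ((a-b+1)*(g₀ t - g₁ t)*(g₁ t - 1/2 - ρ t)) /
          (2*(a * ρ t - (b-1)*(g₀ t - g₁ t)) * r t)
        = (1+a-b)*(g₁ t - 1/2 - ρ t)/((Z t*ρ t+2*(1-b))*r t) := by
      have e1 : g₀ t - g₁ t = 2*a/Z t := by rw [hq t ht]; ring
      have e2 : a * ρ t - (b-1)*(2*a/Z t) = a*(Z t*ρ t+2*(1-b))/Z t := by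
        field_simp; ring
      rw [e1, e2]
      field_simp
      ring
    have h2 : (1+a-b)/P t = (1+a-b)*(g₁ t - 1/2 - ρ t)/((Z t*ρ t+2*(1-b))*r t) := by
      rw [div_eq_div_iff (hP0 t ht) (mul_ne_zero hm hr0), hP]
      linear_combination (-(4*(1+a-b)*r t*(Z t*ρ t+2*(1-b)))) * huv t ht
    rw [hGeq t ht, h1, h2, hT₂def]
    field_simp
    ring
  have hcomp : ∀ t ∈ U, HasDerivAt (fun t => G₀ (T₂ t)) (deriv G₀ (T₂ t) * (-1/(8*r t^3))) t := by
    intro t ht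
    exact (hGdiff _ (hWsub t ht)).1.hasDerivAt.comp t (hT t ht)
  have hsys2 : ∀ t ∈ U,
      (T₂ t*(T₂ t-1)*deriv G₀ (T₂ t) = G₀ (T₂ t)*(G₀ (T₂ t)-1)*(G₀ (T₂ t)-T₂ t)*P t
        + ((-(1/2))*((G₀ (T₂ t)-1)*(G₀ (T₂ t)-T₂ t)) + (-(1/2))*(G₀ (T₂ t)*(G₀ (T₂ t)-T₂ t))
        + (-a+1)*(G₀ (T₂ t)*(G₀ (T₂ t)-1)))) ∧
      -(r t/2)*deriv P t = -((3*G₀ (T₂ t)^2-2*(1+T₂ t)*G₀ (T₂ t)+T₂ t)*P t^2/2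
      + ((-(1/2))*(2*G₀ (T₂ t)-1-T₂ t)+(-(1/2))*(2*G₀ (T₂ t)-T₂ t)+(-a+1)*(2*G₀ (T₂ t)-1))*P t
      + ((-(1/2)+-(1/2)+-a+1)^2-(b-1)^2)/2) := by
    intro t ht
    have hr0 := (hr t ht).2
    have hvd := ((hqdiff t ht).hasDerivAt.sub_const (1/2)).sub (hρdiff t ht).hasDerivAt
    have hPdt := (hPd t ht).differentiableAt.hasDerivAt
    have hg := ((hT t ht).sub (hvd.div ((hrdiff t ht).hasDerivAt.const_mul 2)
      (mul_ne_zero two_ne_zero hr0))).add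
        ((hasDerivAt_const t (1+a-b)).div hPdt (hP0 t ht))
    have hGd := ((hcomp t ht).congr_of_eventuallyEq (Filter.eventuallyEq_of_mem (hU.mem_nhds ht)
      (fun u hu => (hG u hu).symm))).unique hg
    have key := quad_param a b t (r t) (g₁ t) (ρ t) (Z t) (deriv r t) (deriv g₁ t) (deriv ρ t)
      (deriv Z t) (G₀ (T₂ t)) (T₂ t) (deriv G₀ (T₂ t) * (-1/(8*r t^3))) (P t) (deriv P t)
      (g₁ t - 1/2 - ρ t) (deriv g₁ t - deriv ρ t) hr0 (hr t ht).1 (hρ t ht) (hrd t ht) (hρd t ht)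
      (hsys t ht).1 (hsys t ht).2 rfl rfl (hden' t ht) (hT₂def t) (by rw [hP])
      (hPd t ht).deriv (hG t ht) (by
        rw [hGd]
        have := hP0 t ht
        simp only [Pi.sub_apply]
        field_simp
        ring)
    refine ⟨?_, key.2⟩
    rw [← key.1, hTT t ht]
    field_simp
    ring
  -- conclusion
  obtain ⟨a0, a1, b0, b1, bT⟩ := havoid t₀ ht₀
  have hr0 := (hr t₀ ht₀).2
  have D2 := (hGdiff _ (hWsub t₀ ht₀)).2.hasDerivAt.comp t₀ (hT t₀ ht₀)
  have D1 := hcomp t₀ ht₀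
  have DP := (hPd t₀ ht₀).differentiableAt.hasDerivAt
  have I := hT t₀ ht₀
  have hL := ((I.mul (I.sub_const 1)).mul D2)
  have hR := (((D1.mul (D1.sub_const 1)).mul (D1.sub I)).mul DP).add
    (((((D1.sub_const 1).mul (D1.sub I)).const_mul (-(1/2))).add
      ((D1.mul (D1.sub I)).const_mul (-(1/2)))).add ((D1.mul (D1.sub_const 1)).const_mul (-a+1)))
  have hB := (hL.congr_of_eventuallyEq (Filter.eventuallyEq_of_mem (hU.mem_nhds ht₀)
    (fun u hu => ((hsys2 u hu).1).symm))).unique hR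
  rw [PVIAt, pviRHS]
  have key := pvi_of_system (-(1/2)) (-(1/2)) (-a) b (T₂ t₀) (G₀ (T₂ t₀)) (deriv G₀ (T₂ t₀))
    (deriv (deriv G₀) (T₂ t₀)) (P t₀) (deriv P t₀ * (-(8*r t₀^3))) a0 (sub_ne_zero.mpr a1) b0
    (sub_ne_zero.mpr b1) (sub_ne_zero.mpr bT) (hsys2 t₀ ht₀).1 (by
      have hk : (-1/(8*r t₀^3)) * (-(8*r t₀^3)) = 1 := by field_simp
      generalize -(8*r t₀^3) = m at hk ⊢
      generalize -1/(8*r t₀^3) = k at hk hB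
      simp at hB
      linear_combination m*hB - ((2*T₂ t₀-1)*deriv G₀ (T₂ t₀)
        + T₂ t₀*(T₂ t₀-1)*deriv (deriv G₀) (T₂ t₀)
        - (((3*G₀ (T₂ t₀)^2-2*(1+T₂ t₀)*G₀ (T₂ t₀)+T₂ t₀)*deriv G₀ (T₂ t₀)
          - G₀ (T₂ t₀)*(G₀ (T₂ t₀)-1))*P t₀
        + (((-(1/2))*(2*G₀ (T₂ t₀)-1-T₂ t₀)+(-(1/2))*(2*G₀ (T₂ t₀)-T₂ t₀)
          +(-a+1)*(2*G₀ (T₂ t₀)-1))*deriv G₀ (T₂ t₀) - (-(1/2))*(G₀ (T₂ t₀)-1)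
          - (-(1/2))*G₀ (T₂ t₀))))*hk) (by
      rw [← (hsys2 t₀ ht₀).2, hTT t₀ ht₀]
      field_simp
      ring)
  rw [key]
  ring
end

section
/- Let ν₀, ν₁, ν_t, ν∞ ∈ ℂ and let y be a differentiable function on an open set U ⊆ ℂ with y(t) ∉ {0,1,t} and t ∉ {0,1} on U, such that the Okamoto operator K_{[ν₀,ν₁,ν_t,1+ν∞;t]} y is defined on U. Let Y be the function defined by Y(T) = 1 − y(1−T) on the open set {1−t : t ∈ U}. Then the Okamoto operator K_{[ν₁,ν₀,ν_t,1+ν∞;T]} Y is defined there, and for every t ∈ U one has 1 − (K_{[ν₀,ν₁,ν_t,1+ν∞;t]} y)(t) = (K_{[ν₁,ν₀,ν_t,1+ν∞;T]} Y)(1−t). (This is the commutation of the Okamoto operator with the fractional-linear transformation t ↦ 1−t, y ↦ 1−y, which interchanges the first two parameters.) -/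
/-- The Okamoto operator commutes with the fractional-linear transformation
`t ↦ 1−t`, `y ↦ 1−y`, which interchanges the first two parameters. -/
theorem okamoto_commutes_fractional_linear
    (ν0 ν1 νt νinf : ℂ) (U : Set ℂ) (hU : IsOpen U)
    (y : ℂ → ℂ)
    (hydiff : ∀ t ∈ U, DifferentiableAt ℂ y t)
    (hreg : ∀ t ∈ U, t ≠ 0 ∧ t ≠ 1 ∧ y t ≠ 0 ∧ y t ≠ 1 ∧ y t ≠ t)
    (hZ : ∀ t ∈ U, okZ ν0 ν1 νt y t ≠ 0) :
    ∀ t ∈ U, okZ ν1 ν0 νt (fun T => 1 - y (1 - T)) (1 - t) ≠ 0 ∧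
      1 - okK ν0 ν1 νt (1+νinf) y t
        = okK ν1 ν0 νt (1+νinf) (fun T => 1 - y (1 - T)) (1 - t) := by
  intro t ht
  have _ := hU
  obtain ⟨-, -, h0, h1, h2⟩ := hreg t ht
  have hd : deriv (fun T => 1 - y (1 - T)) (1 - t) = deriv y t := by
    have hy : HasDerivAt y (deriv y t) (1 - (1 - t)) := by
      rw [sub_sub_cancel]
      exact (hydiff t ht).hasDerivAt
    have h := (hy.comp_const_sub 1 (1 - t)).const_sub 1
    rw [neg_neg] at h
    exact h.deriv
  have hneg : okZ ν1 ν0 νt (fun T => 1 - y (1 - T)) (1 - t) = -okZ ν0 ν1 νt y t := by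
    unfold okZ
    rw [hd]
    simp only [sub_sub_cancel]
    have e1 : 1 - y t = -(y t - 1) := by ring
    have e2 : 1 - y t - 1 = -y t := by ring
    have e3 : 1 - y t - (1 - t) = -(y t - t) := by ring
    rw [e2, e3, e1, div_neg, div_neg, div_neg]
    ring
  refine ⟨by rw [hneg]; exact neg_ne_zero.mpr (hZ t ht), ?_⟩
  unfold okK
  rw [hneg, div_neg]
  simp only [sub_sub_cancel]
  ring
end

section
/- Let A, B ∈ ℂ. Suppose y₁ is a solution of P_VI(0, A, B, 1; t₁) and y₂ is a solution of P_VI(0, B−1, A+1, 1; t₁), both on an open set U ⊆ ℂ, with K_{[0,A,−B,1;t₁]} y₁ = K_{[0,B−1,−A−1,1;t₁]} y₂ =: y₀ defined on U. Let V ⊆ ℂ be open with τ² ∈ U and τ ∉ {0,1,−1} for τ ∈ V, and let η : V → ℂ be differentiable with η(τ)² = y₁(τ²), η(τ) ≠ 1, and y₀(τ²) ≠ η(τ) for all τ ∈ V. Suppose Y₁ and Y₂ are twice differentiable on a neighbourhood of {(τ+1)²/(τ−1)² : τ ∈ V}, with Y₁((τ+1)²/(τ−1)²) = (τ+1)(η(τ)+1)/((τ−1)(η(τ)−1))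 and Y₂((τ+1)²/(τ−1)²) = (τ+1)(y₀(τ²)+η(τ))/((τ−1)(y₀(τ²)−η(τ))) for all τ ∈ V, avoiding 0, 1 and their argument where it lies outside {0,1}. Then: (i) Y₁ satisfies P_VI(A/2, B/2, B/2, A/2+1; T₁) at every T₁ = (τ+1)²/(τ−1)², τ ∈ V; (ii) Y₂ satisfies P_VI((B−1)/2, (A+1)/2, (A+1)/2, (B+1)/2; T₁) at these points; and (iii) Y₂ = K_{[A/2, −B/2, −B/2, A/2+1; T₁]} Y₁ at these points. -/
open Filter Topology

/-- The numerator part of the first order system equivalent to Painleve VI. -/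
noncomputable def sysF (n0 n1 nt : ℂ) (y z t : ℂ) : ℂ :=
  (y*(y-1)*(y-t)*z + n0*(y-1)*(y-t) + n1*y*(y-t) + (1+nt)*y*(y-1)) / (t*(t-1))

noncomputable def sysG (n0 n1 nt ni : ℂ) (y z t : ℂ) : ℂ :=
  -(((y-1)*(y-t) + y*(y-t) + y*(y-1))*z^2/2
    + (n0*((y-t)+(y-1)) + n1*((y-t)+y) + (1+nt)*((y-1)+y))*z
    + (n0+n1+nt+ni)*(n0+n1+nt-ni+2)/2) / (t*(t-1))

lemma okZ_eq (n0 n1 nt : ℂ) (y : ℂ → ℂ) (t : ℂ) (h0 : y t ≠ 0) (h1 : y t - 1 ≠ 0)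
    (ht : y t - t ≠ 0) :
    okZ n0 n1 nt y t = (t*(t-1)*deriv y t - (n0*(y t-1)*(y t-t) + n1*y t*(y t-t)
      + (1+nt)*y t*(y t-1))) / (y t*(y t-1)*(y t-t)) := by
  unfold okZ
  field_simp
  ring

lemma deriv_eq_sysF (n0 n1 nt : ℂ) (y : ℂ → ℂ) (t : ℂ) (h0 : y t ≠ 0) (h1 : y t - 1 ≠ 0)
    (ht : y t - t ≠ 0) (t0 : t ≠ 0) (t1 : t - 1 ≠ 0) :
    deriv y t = sysF n0 n1 nt (y t) (okZ n0 n1 nt y t) t := by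
  rw [okZ_eq n0 n1 nt y t h0 h1 ht]
  unfold sysF
  field_simp
  ring

/-- Painleve VI implies the first order system. -/
lemma pvi_to_sys (n0 n1 nt ni : ℂ) (y : ℂ → ℂ) (t : ℂ) (h0 : y t ≠ 0) (h1 : y t - 1 ≠ 0)
    (ht : y t - t ≠ 0) (t0 : t ≠ 0) (t1 : t - 1 ≠ 0)
    (hd : DifferentiableAt ℂ y t) (hd2 : DifferentiableAt ℂ (deriv y) t)
    (hp : PVIAt n0 n1 nt ni y t) :
    HasDerivAt (okZ n0 n1 nt y) (sysG n0 n1 nt ni (y t) (okZ n0 n1 nt y t) t) t := by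
  have hy := hd.hasDerivAt
  have hy2 := hd2.hasDerivAt
  have hi := hasDerivAt_id' t
  have key := ((((hi.sub_const 1).mul hy2).sub_const n0).div hy h0).sub
    (((hi.mul hy2).add_const n1).div (hy.sub_const 1) h1) |>.add
    (((hy2.sub_const 1).sub_const nt).div (hy.sub hi) ht)
  refine key.congr_deriv ?_
  unfold PVIAt pviRHS at hp
  rw [hp, okZ_eq n0 n1 nt y t h0 h1 ht]
  unfold sysG
  simp only [Pi.sub_apply, Pi.mul_apply]
  generalize deriv y t = d
  generalize y t = q at *
  field_simp
  ring

/-- The first order system implies Painleve VI. -/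
lemma sys_to_pvi (n0 n1 nt ni : ℂ) (y z : ℂ → ℂ) (t : ℂ) (h0 : y t ≠ 0) (h1 : y t - 1 ≠ 0)
    (ht : y t - t ≠ 0) (t0 : t ≠ 0) (t1 : t - 1 ≠ 0)
    (hd : DifferentiableAt ℂ y t)
    (hF : ∀ᶠ u in 𝓝 t, deriv y u = sysF n0 n1 nt (y u) (z u) u)
    (hG : HasDerivAt z (sysG n0 n1 nt ni (y t) (z t) t) t) :
    PVIAt n0 n1 nt ni y t := by
  have hy := hd.hasDerivAt
  have hi := hasDerivAt_id' t
  have a0 := hy.sub_const 1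
  have ayt := hy.sub hi
  have key := ((((hy.mul a0).mul ayt).mul hG).add ((a0.const_mul n0).mul ayt) |>.add
    ((hy.const_mul n1).mul ayt) |>.add ((hy.const_mul (1+nt)).mul a0)).div
    (hi.mul (hi.sub_const 1)) (mul_ne_zero t0 t1)
  have hd0 := hF.self_of_nhds
  have k2 : HasDerivAt (deriv y) _ t := key.congr_of_eventuallyEq hF
  unfold PVIAt pviRHS
  rw [k2.deriv]
  simp only [Pi.sub_apply, Pi.mul_apply, Pi.add_apply]
  rw [hd0]
  unfold sysF sysG
  generalize z t = w
  generalize y t = q at *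
  field_simp
  ring

lemma ok_alg_F (n0 n1 nt ni s y z t : ℂ) (hs : s = n0+n1+nt+ni) (hz : z ≠ 0)
    (t0 : t ≠ 0) (t1 : t - 1 ≠ 0) :
    sysF n0 n1 nt y z t - s * sysG n0 n1 nt ni y z t / z^2
      = sysF (n0-s/2) (n1-s/2) (nt-s/2) (y+s/z) z t := by
  subst hs
  unfold sysF sysG
  field_simp
  ring

lemma ok_alg_G (n0 n1 nt ni s y z t : ℂ) (hs : s = n0+n1+nt+ni) (hz : z ≠ 0)
    (t0 : t ≠ 0) (t1 : t - 1 ≠ 0) :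
    sysG n0 n1 nt ni y z t
      = sysG (n0-s/2) (n1-s/2) (nt-s/2) (ni-s/2) (y+s/z) z t := by
  subst hs
  unfold sysG
  field_simp
  ring

/-- The Okamoto transformation. -/
lemma okamoto (n0 n1 nt ni s : ℂ) (hs : s = n0+n1+nt+ni) (y Q : ℂ → ℂ) (O : Set ℂ)
    (hO : IsOpen O)
    (hne : ∀ t ∈ O, t ≠ 0 ∧ t - 1 ≠ 0 ∧ y t ≠ 0 ∧ y t - 1 ≠ 0 ∧ y t - t ≠ 0)
    (hd : ∀ t ∈ O, DifferentiableAt ℂ y t ∧ DifferentiableAt ℂ (deriv y) t)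
    (hp : ∀ t ∈ O, PVIAt n0 n1 nt ni y t)
    (hz : ∀ t ∈ O, okZ n0 n1 nt y t ≠ 0)
    (hQ : ∀ t ∈ O, Q t = okK n0 n1 nt ni y t)
    (t : ℂ) (htO : t ∈ O) (hQ0 : Q t ≠ 0) (hQ1 : Q t - 1 ≠ 0) (hQt : Q t - t ≠ 0) :
    PVIAt (n0-s/2) (n1-s/2) (nt-s/2) (ni-s/2) Q t := by
  have hzd : ∀ u ∈ O, HasDerivAt (okZ n0 n1 nt y)
      (sysG n0 n1 nt ni (y u) (okZ n0 n1 nt y u) u) u := fun u hu => by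
    obtain ⟨a, b, c, d, e⟩ := hne u hu
    exact pvi_to_sys n0 n1 nt ni y u c d e a b (hd u hu).1 (hd u hu).2 (hp u hu)
  have hQe : ∀ u ∈ O, Q u = y u + s / okZ n0 n1 nt y u := fun u hu => by
    rw [hQ u hu, okK, hs]
  have hQd : ∀ u ∈ O, HasDerivAt Q (sysF (n0-s/2) (n1-s/2) (nt-s/2) (Q u)
      (okZ n0 n1 nt y u) u) u := fun u hu => by
    obtain ⟨a, b, c, d, e⟩ := hne u hu
    have h1 := (hd u hu).1.hasDerivAt.add ((hasDerivAt_const u s).div (hzd u hu) (hz u hu))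
    have h2 : Q =ᶠ[𝓝 u] (y + fun v => s / okZ n0 n1 nt y v) := by
      filter_upwards [hO.mem_nhds hu] with v hv using hQe v hv
    refine (h1.congr_of_eventuallyEq h2).congr_deriv ?_
    rw [hQe u hu, ← ok_alg_F n0 n1 nt ni s _ _ u hs (hz u hu) a b,
      ← deriv_eq_sysF n0 n1 nt y u c d e a b]
    ring
  obtain ⟨a, b, c, d, e⟩ := hne t htO
  refine sys_to_pvi _ _ _ _ Q (okZ n0 n1 nt y) t hQ0 hQ1 hQt a b
    (hQd t htO).differentiableAt ?_ ?_
  · filter_upwards [hO.mem_nhds htO] with u hu using (hQd u hu).deriv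
  · rw [hQe t htO, ← ok_alg_G n0 n1 nt ni s _ _ t hs (hz t htO) a b]
    exact hzd t htO

/-- Derivative of the quadratic change of variable. -/
lemma phi_deriv (τ : ℂ) (h : τ - 1 ≠ 0) :
    HasStrictDerivAt (fun τ : ℂ => (τ+1)^2/(τ-1)^2) (-4*(τ+1)/(τ-1)^3) τ := by
  have hi : HasStrictDerivAt (fun x : ℂ => x) 1 τ := hasStrictDerivAt_id τ
  have hp : HasStrictDerivAt (fun x : ℂ => x + 1) 1 τ := hi.add_const 1
  have hm : HasStrictDerivAt (fun x : ℂ => x - 1) 1 τ := hi.sub_const 1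
  have := (HasStrictDerivAt.fun_pow hp 2).fun_div (HasStrictDerivAt.fun_pow hm 2) (pow_ne_zero 2 h)
  refine this.congr_deriv ?_
  field_simp
  ring

/-- the derivative of `Y₁` pulled back: algebraic form of `okZ` for `Y₁`. -/
lemma quad_alg_Z (A B τ e z T Y d : ℂ) (a : τ ≠ 0) (b : τ - 1 ≠ 0) (c : τ + 1 ≠ 0)
    (e0 : e ≠ 0) (e1 : e - 1 ≠ 0)
    (hd : d = τ * sysF 0 A (-B) (e^2) z (τ^2) / e)
    (hT : T = (τ+1)^2/(τ-1)^2) (hY : Y = (τ+1)*(e+1)/((τ-1)*(e-1))) :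
    (τ-1)*(e+1)/(2*(τ+1)*(e-1)) + (τ-1)^2*d/(2*(e-1)^2)
     = sysF (A/2) (-B/2) (-B/2) Y (-(τ-1)*(e-1)*(z*e*(e-1)+(A-B+1))/(2*(τ+1))) T := by
  have t1 : τ^2 - 1 ≠ 0 := by
    have : τ^2 - 1 = (τ-1)*(τ+1) := by ring
    rw [this]; exact mul_ne_zero b c
  have T1 : (τ+1)^2/(τ-1)^2 - 1 = 4*τ/(τ-1)^2 := by field_simp; ring
  subst hd hT hY
  unfold sysF
  rw [T1]
  field_simp
  ring

lemma quad_alg_G (A B τ e z T Y d g : ℂ) (a : τ ≠ 0) (b : τ - 1 ≠ 0) (c : τ + 1 ≠ 0)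
    (e0 : e ≠ 0) (e1 : e - 1 ≠ 0)
    (hd : d = τ * sysF 0 A (-B) (e^2) z (τ^2) / e)
    (hg : g = 2 * τ * sysG 0 A (-B) 1 (e^2) z (τ^2))
    (hT : T = (τ+1)^2/(τ-1)^2) (hY : Y = (τ+1)*(e+1)/((τ-1)*(e-1))) :
    -1/(τ+1)^2 * ((e-1)*(z*e*(e-1)+(A-B+1)))
      - (τ-1)/(2*(τ+1)) * (d*(z*e*(e-1)+(A-B+1)) + (e-1)*(g*e*(e-1) + z*(2*e-1)*d))
     = sysG (A/2) (-B/2) (-B/2) (A/2+1) Y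
        (-(τ-1)*(e-1)*(z*e*(e-1)+(A-B+1))/(2*(τ+1))) T * (-4*(τ+1)/(τ-1)^3) := by
  have t1 : τ^2 - 1 ≠ 0 := by
    have : τ^2 - 1 = (τ-1)*(τ+1) := by ring
    rw [this]; exact mul_ne_zero b c
  have T1 : (τ+1)^2/(τ-1)^2 - 1 = 4*τ/(τ-1)^2 := by field_simp; ring
  subst hd hg hT hY
  unfold sysF sysG
  rw [T1]
  field_simp
  ring

lemma okZ_differentiableAt (n0 n1 nt : ℂ) (y : ℂ → ℂ) (t : ℂ) (h0 : y t ≠ 0) (h1 : y t - 1 ≠ 0)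
    (ht : y t - t ≠ 0)
    (hd : DifferentiableAt ℂ y t) (hd2 : DifferentiableAt ℂ (deriv y) t) :
    DifferentiableAt ℂ (okZ n0 n1 nt y) t := by
  unfold okZ
  have := differentiableAt_id (𝕜 := ℂ) (x := t)
  fun_prop (disch := assumption)

lemma sysF_inj (n0 n1 nt y z w t : ℂ) (h0 : y ≠ 0) (h1 : y - 1 ≠ 0)
    (ht : y - t ≠ 0) (t0 : t ≠ 0) (t1 : t - 1 ≠ 0)
    (h : sysF n0 n1 nt y z t = sysF n0 n1 nt y w t) : z = w := by
  unfold sysF at h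
  rw [div_left_inj' (mul_ne_zero t0 t1)] at h
  have : y*(y-1)*(y-t)*z = y*(y-1)*(y-t)*w := by linear_combination h
  exact mul_left_cancel₀ (mul_ne_zero (mul_ne_zero h0 h1) ht) this

/-- Lemma 4 of Vidunas–Kitaev: compatibility of the simple quadratic transformation
with Okamoto transformations. -/
theorem quadratic_okamoto_compatibility
    (A B : ℂ) (U : Set ℂ) (y₁ y₂ : ℂ → ℂ)
    (hy₁ : IsPVISolutionOn 0 A B 1 y₁ U)
    (hy₂ : IsPVISolutionOn 0 (B-1) (A+1) 1 y₂ U)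
    (hZ1 : ∀ t ∈ U, okZ 0 A (-B) y₁ t ≠ 0)
    (hZ2 : ∀ t ∈ U, okZ 0 (B-1) (-A-1) y₂ t ≠ 0)
    (y₀ : ℂ → ℂ)
    (hy₀def : ∀ t ∈ U, y₀ t = okK 0 A (-B) 1 y₁ t)
    (heq : ∀ t ∈ U, okK 0 A (-B) 1 y₁ t = okK 0 (B-1) (-A-1) 1 y₂ t)
    (V : Set ℂ) (hVopen : IsOpen V)
    (hV : ∀ τ ∈ V, τ^2 ∈ U ∧ τ ≠ 0 ∧ τ ≠ 1 ∧ τ ≠ -1)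
    (η : ℂ → ℂ) (hηdiff : ∀ τ ∈ V, DifferentiableAt ℂ η τ)
    (hη : ∀ τ ∈ V, (η τ)^2 = y₁ (τ^2) ∧ η τ ≠ 1 ∧ y₀ (τ^2) ≠ η τ)
    (Y₁ Y₂ : ℂ → ℂ) (W : Set ℂ) (hWopen : IsOpen W)
    (hWsub : ∀ τ ∈ V, (τ+1)^2/(τ-1)^2 ∈ W)
    (hY₁diff : ∀ T ∈ W, DifferentiableAt ℂ Y₁ T ∧ DifferentiableAt ℂ (deriv Y₁) T)
    (hY₂diff : ∀ T ∈ W, DifferentiableAt ℂ Y₂ T ∧ DifferentiableAt ℂ (deriv Y₂) T)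
    (hY₁eq : ∀ τ ∈ V, Y₁ ((τ+1)^2/(τ-1)^2) = (τ+1)*(η τ+1)/((τ-1)*(η τ-1)))
    (hY₂eq : ∀ τ ∈ V, Y₂ ((τ+1)^2/(τ-1)^2)
      = (τ+1)*(y₀ (τ^2)+η τ)/((τ-1)*(y₀ (τ^2)-η τ)))
    (havoid₁ : ∀ τ ∈ V, (τ+1)^2/(τ-1)^2 ≠ 0 ∧ (τ+1)^2/(τ-1)^2 ≠ 1 ∧
      Y₁ ((τ+1)^2/(τ-1)^2) ≠ 0 ∧ Y₁ ((τ+1)^2/(τ-1)^2) ≠ 1 ∧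
      Y₁ ((τ+1)^2/(τ-1)^2) ≠ (τ+1)^2/(τ-1)^2)
    (havoid₂ : ∀ τ ∈ V, Y₂ ((τ+1)^2/(τ-1)^2) ≠ 0 ∧ Y₂ ((τ+1)^2/(τ-1)^2) ≠ 1 ∧
      Y₂ ((τ+1)^2/(τ-1)^2) ≠ (τ+1)^2/(τ-1)^2) :
    (∀ τ ∈ V, PVIAt (A/2) (B/2) (B/2) (A/2+1) Y₁ ((τ+1)^2/(τ-1)^2)) ∧
    (∀ τ ∈ V, PVIAt ((B-1)/2) ((A+1)/2) ((A+1)/2) ((B+1)/2) Y₂ ((τ+1)^2/(τ-1)^2)) ∧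
    (∀ τ ∈ V, Y₂ ((τ+1)^2/(τ-1)^2)
      = okK (A/2) (-B/2) (-B/2) (A/2+1) Y₁ ((τ+1)^2/(τ-1)^2)) := by
  obtain ⟨-, hne, hdf, hpv⟩ := hy₁
  -- basic non-vanishing facts
  have nz : ∀ τ ∈ V, τ ≠ 0 ∧ τ - 1 ≠ 0 ∧ τ + 1 ≠ 0 ∧ η τ ≠ 0 ∧ η τ - 1 ≠ 0 := by
    intro τ hτ
    obtain ⟨hU, h0, h1, h2⟩ := hV τ hτ
    obtain ⟨g1, g2, -⟩ := hη τ hτ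
    obtain ⟨-, -, k0, -, -⟩ := hne _ hU
    refine ⟨h0, sub_ne_zero.2 h1, fun h => h2 (eq_neg_of_add_eq_zero_left h), ?_,
      sub_ne_zero.2 g2⟩
    intro h
    exact k0 (by rw [← g1, h]; ring)
  -- derivative of `η`
  have hηd : ∀ τ ∈ V, HasDerivAt η (τ * sysF 0 A (-B) ((η τ)^2)
      (okZ 0 A (-B) y₁ (τ^2)) (τ^2) / η τ) τ := by
    intro τ hτ
    obtain ⟨a, b, c, e0, e1⟩ := nz τ hτ
    obtain ⟨hU, -, -, -⟩ := hV τ hτ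
    obtain ⟨k, k1, k2, k3, k4⟩ := hne _ hU
    have hd := (hηdiff τ hτ).hasDerivAt
    have hsq : HasDerivAt (fun x : ℂ => x^2) (2*τ) τ := by
      simpa using hasDerivAt_pow 2 τ
    have h1 : HasDerivAt (fun x => y₁ (x^2)) (deriv y₁ (τ^2) * (2*τ)) τ :=
      HasDerivAt.comp τ (h₂ := y₁) (hdf _ hU).1.hasDerivAt hsq
    have h2 : HasDerivAt (fun x => (η x)^2) (2 * η τ * deriv η τ) τ := by
      simpa using hd.fun_pow 2
    have h3 : (fun x => y₁ (x^2)) =ᶠ[𝓝 τ] (fun x => (η x)^2) := by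
      filter_upwards [hVopen.mem_nhds hτ] with x hx using (hη x hx).1.symm
    have h4 := (h2.congr_of_eventuallyEq h3).unique h1
    rw [deriv_eq_sysF 0 A (-B) y₁ (τ^2) k2 (sub_ne_zero.2 k3) (sub_ne_zero.2 k4) k
      (sub_ne_zero.2 k1), ← (hη τ hτ).1] at h4
    refine hd.congr_deriv ?_
    rw [eq_div_iff e0]
    linear_combination h4 / 2
  -- derivative of the auxiliary variable
  have hzd : ∀ τ ∈ V, HasDerivAt (fun x => okZ 0 A (-B) y₁ (x^2))
      (2 * τ * sysG 0 A (-B) 1 ((η τ)^2) (okZ 0 A (-B) y₁ (τ^2)) (τ^2)) τ := by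
    intro τ hτ
    obtain ⟨hU, -, -, -⟩ := hV τ hτ
    obtain ⟨k, k1, k2, k3, k4⟩ := hne _ hU
    have hsq : HasDerivAt (fun x : ℂ => x^2) (2*τ) τ := by
      simpa using hasDerivAt_pow 2 τ
    have hp : PVIAt 0 A (-B) 1 y₁ (τ^2) := by
      have := hpv _ hU
      simpa only [PVIAt, pviRHS, neg_sq] using this
    have h1 := pvi_to_sys 0 A (-B) 1 y₁ (τ^2) k2 (sub_ne_zero.2 k3) (sub_ne_zero.2 k4) k
      (sub_ne_zero.2 k1) (hdf _ hU).1 (hdf _ hU).2 hp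
    have h2 := HasDerivAt.comp τ (h₂ := okZ 0 A (-B) y₁) h1 hsq
    refine h2.congr_deriv ?_
    rw [(hη τ hτ).1]
    ring
  have nzT : ∀ τ ∈ V, (τ+1)^2/(τ-1)^2 ≠ 0 ∧ (τ+1)^2/(τ-1)^2 - 1 ≠ 0 ∧
      Y₁ ((τ+1)^2/(τ-1)^2) ≠ 0 ∧ Y₁ ((τ+1)^2/(τ-1)^2) - 1 ≠ 0 ∧
      Y₁ ((τ+1)^2/(τ-1)^2) - (τ+1)^2/(τ-1)^2 ≠ 0 := by
    intro τ hτ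
    obtain ⟨a, b, c, d, e⟩ := havoid₁ τ hτ
    exact ⟨a, sub_ne_zero.2 b, c, sub_ne_zero.2 d, sub_ne_zero.2 e⟩
  -- the Okamoto denominator for `Y₁`
  have hZY : ∀ τ ∈ V, okZ (A/2) (-B/2) (-B/2) Y₁ ((τ+1)^2/(τ-1)^2)
      = -(τ-1)*(η τ-1)*(okZ 0 A (-B) y₁ (τ^2)*η τ*(η τ-1)+(A-B+1))/(2*(τ+1)) := by
    intro τ hτ
    obtain ⟨a, b, c, e0, e1⟩ := nz τ hτ
    obtain ⟨T0, T1, q0, q1, qt⟩ := nzT τ hτ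
    have hφ := (phi_deriv τ b).hasDerivAt
    have h1 : HasDerivAt (fun x : ℂ => Y₁ ((x+1)^2/(x-1)^2))
        (deriv Y₁ ((τ+1)^2/(τ-1)^2) * (-4*(τ+1)/(τ-1)^3)) τ :=
      HasDerivAt.comp τ (h₂ := Y₁) (hY₁diff _ (hWsub τ hτ)).1.hasDerivAt hφ
    have hi := hasDerivAt_id' τ
    have h2 := ((hi.add_const 1).fun_mul ((hηd τ hτ).add_const 1)).fun_div
      ((hi.sub_const 1).fun_mul ((hηd τ hτ).sub_const 1)) (mul_ne_zero b e1)
    have h3 : (fun x : ℂ => Y₁ ((x+1)^2/(x-1)^2)) =ᶠ[𝓝 τ]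
        (fun x => (x+1)*(η x+1)/((x-1)*(η x-1))) := by
      filter_upwards [hVopen.mem_nhds hτ] with x hx using hY₁eq x hx
    have h4 := (h2.congr_of_eventuallyEq h3).unique h1
    apply sysF_inj (A/2) (-B/2) (-B/2) _ _ _ _ q0 q1 qt T0 T1
    rw [← deriv_eq_sysF (A/2) (-B/2) (-B/2) Y₁ _ q0 q1 qt T0 T1,
      ← quad_alg_Z A B τ (η τ) (okZ 0 A (-B) y₁ (τ^2)) _ _ _ a b c e0 e1 rfl rfl (hY₁eq τ hτ)]
    generalize τ * sysF 0 A (-B) ((η τ)^2) (okZ 0 A (-B) y₁ (τ^2)) (τ^2) / η τ = d at *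
    have hk : (-4*(τ+1)/(τ-1)^3) ≠ 0 := by
      refine div_ne_zero (mul_ne_zero (by norm_num) c) (pow_ne_zero _ b)
    refine mul_right_cancel₀ hk ?_
    rw [← h4]
    field_simp
    ring
  -- the image of `V` is open
  have hO : IsOpen ((fun τ : ℂ => (τ+1)^2/(τ-1)^2) '' V) := by
    rw [isOpen_iff_mem_nhds]
    rintro _ ⟨τ, hτ, rfl⟩
    obtain ⟨a, b, c, e0, e1⟩ := nz τ hτ
    have hk : (-4*(τ+1)/(τ-1)^3) ≠ 0 := by
      refine div_ne_zero (mul_ne_zero (by norm_num) c) (pow_ne_zero _ b)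
    rw [← (phi_deriv τ b).map_nhds_eq hk]
    exact image_mem_map (hVopen.mem_nhds hτ)
  -- part (i), with signed parameters
  have part1 : ∀ τ ∈ V, PVIAt (A/2) (-B/2) (-B/2) (A/2+1) Y₁ ((τ+1)^2/(τ-1)^2) := by
    intro τ hτ
    obtain ⟨a, b, c, e0, e1⟩ := nz τ hτ
    obtain ⟨T0, T1, q0, q1, qt⟩ := nzT τ hτ
    have hW := hY₁diff _ (hWsub τ hτ)
    have hφ := (phi_deriv τ b).hasDerivAt
    have hk : (-4*(τ+1)/(τ-1)^3) ≠ 0 := by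
      refine div_ne_zero (mul_ne_zero (by norm_num) c) (pow_ne_zero _ b)
    refine sys_to_pvi _ _ _ _ Y₁ (okZ (A/2) (-B/2) (-B/2) Y₁) _ q0 q1 qt T0 T1 hW.1 ?_ ?_
    · filter_upwards [hO.mem_nhds ⟨τ, hτ, rfl⟩] with u hu
      obtain ⟨σ, hσ, rfl⟩ := hu
      obtain ⟨T0, T1, q0, q1, qt⟩ := nzT σ hσ
      exact deriv_eq_sysF _ _ _ Y₁ _ q0 q1 qt T0 T1
    · have hzz := (okZ_differentiableAt (A/2) (-B/2) (-B/2) Y₁ _ q0 q1 qt hW.1 hW.2).hasDerivAt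
      refine hzz.congr_deriv ?_
      have h1 := HasDerivAt.comp τ (h₂ := okZ (A/2) (-B/2) (-B/2) Y₁) hzz hφ
      have hi := hasDerivAt_id' τ
      have hm := (hηd τ hτ).sub_const 1
      have h2 := (((hi.sub_const 1).fun_neg.fun_mul hm).fun_mul
        ((((hzd τ hτ).fun_mul (hηd τ hτ)).fun_mul hm).add_const (A-B+1))).fun_div
        ((hi.add_const 1).const_mul 2) (mul_ne_zero two_ne_zero c)
      have h3 : (okZ (A/2) (-B/2) (-B/2) Y₁ ∘ fun x : ℂ => (x+1)^2/(x-1)^2) =ᶠ[𝓝 τ]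
          (fun x => -(x-1)*(η x-1)*(okZ 0 A (-B) y₁ (x^2)*η x*(η x-1)+(A-B+1))/(2*(x+1))) := by
        filter_upwards [hVopen.mem_nhds hτ] with x hx using hZY x hx
      have h4 := (h2.congr_of_eventuallyEq h3).unique h1
      refine mul_right_cancel₀ hk ?_
      rw [← h4, hZY τ hτ, ← quad_alg_G A B τ (η τ) (okZ 0 A (-B) y₁ (τ^2)) _ _ _ _ a b c e0 e1
        rfl rfl rfl (hY₁eq τ hτ)]
      generalize τ * sysF 0 A (-B) ((η τ)^2) (okZ 0 A (-B) y₁ (τ^2)) (τ^2) / η τ = d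
      generalize 2 * τ * sysG 0 A (-B) 1 ((η τ)^2) (okZ 0 A (-B) y₁ (τ^2)) (τ^2) = g
      field_simp
      ring
  -- the Okamoto relation and nonvanishing of the denominator
  have hrel : ∀ τ ∈ V, okZ 0 A (-B) y₁ (τ^2) * η τ * (η τ - 1) + (A-B+1) ≠ 0 ∧
      y₀ (τ^2) = (η τ)^2 + (A-B+1) / okZ 0 A (-B) y₁ (τ^2) := by
    intro τ hτ
    have hU := (hV τ hτ).1
    have hz := hZ1 _ hU
    have hy : y₀ (τ^2) = (η τ)^2 + (A-B+1) / okZ 0 A (-B) y₁ (τ^2) := by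
      rw [hy₀def _ hU, okK, (hη τ hτ).1]
      ring
    refine ⟨fun h => (hη τ hτ).2.2 ?_, hy⟩
    rw [hy]
    field_simp
    linear_combination h
  have hZne : ∀ τ ∈ V, okZ (A/2) (-B/2) (-B/2) Y₁ ((τ+1)^2/(τ-1)^2) ≠ 0 := by
    intro τ hτ
    obtain ⟨a, b, c, e0, e1⟩ := nz τ hτ
    rw [hZY τ hτ]
    exact div_ne_zero (mul_ne_zero (mul_ne_zero (neg_ne_zero.2 b) e1) (hrel τ hτ).1)
      (mul_ne_zero two_ne_zero c)
  have part3 : ∀ τ ∈ V, Y₂ ((τ+1)^2/(τ-1)^2)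
      = okK (A/2) (-B/2) (-B/2) (A/2+1) Y₁ ((τ+1)^2/(τ-1)^2) := by
    intro τ hτ
    obtain ⟨a, b, c, e0, e1⟩ := nz τ hτ
    have hz := hZ1 _ (hV τ hτ).1
    obtain ⟨r1, r2⟩ := hrel τ hτ
    have r3 : y₀ (τ^2) - η τ = (okZ 0 A (-B) y₁ (τ^2) * η τ * (η τ - 1) + (A-B+1))
        / okZ 0 A (-B) y₁ (τ^2) := by
      rw [r2]
      field_simp
      ring
    have r4 : A/2 + -B/2 + -B/2 + (A/2+1) = A-B+1 := by ring
    rw [okK, hY₂eq τ hτ, hY₁eq τ hτ, hZY τ hτ, r3, r2, r4]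
    generalize okZ 0 A (-B) y₁ (τ^2) = z at *
    generalize η τ = e at *
    generalize hD : z * e * (e - 1) + (A-B+1) = D at *
    obtain rfl : B = A + 1 + z*e*(e-1) - D := by linear_combination -hD
    field_simp
    ring
  refine ⟨?_, ?_, part3⟩
  · intro τ hτ
    have := part1 τ hτ
    simpa only [PVIAt, pviRHS, neg_div, neg_sq] using this
  · intro τ hτ
    obtain ⟨p0, p1, pt⟩ := havoid₂ τ hτ
    have := okamoto (A/2) (-B/2) (-B/2) (A/2+1) (A-B+1) (by ring) Y₁ Y₂ _ hO
      (by rintro _ ⟨σ, hσ, rfl⟩; exact nzT σ hσ)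
      (by rintro _ ⟨σ, hσ, rfl⟩; exact hY₁diff _ (hWsub σ hσ))
      (by rintro _ ⟨σ, hσ, rfl⟩; exact part1 σ hσ)
      (by rintro _ ⟨σ, hσ, rfl⟩; exact hZne σ hσ)
      (by rintro _ ⟨σ, hσ, rfl⟩; exact part3 σ hσ)
      _ ⟨τ, hτ, rfl⟩ p0 (sub_ne_zero.2 p1) (sub_ne_zero.2 pt)
    have w0 : A/2 - (A-B+1)/2 = (B-1)/2 := by ring
    have w1 : -B/2 - (A-B+1)/2 = -((A+1)/2) := by ring
    have w2 : A/2+1 - (A-B+1)/2 = (B+1)/2 := by ring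
    rw [w0, w1, w2] at this
    simpa only [PVIAt, pviRHS, neg_sq] using this
end

section
/- Let A, B ∈ ℂ. Suppose y₁ is a solution of P_VI(0, A, B, 1; t) on an open set U ⊆ ℂ, and y₀ = K_{[0, A, −B, 1; t]} y₁ is defined on U. Let V ⊆ ℂ be open with τ² ∈ U, τ(τ²−1) ≠ 0 for τ ∈ V, and let η : V → ℂ be differentiable with η(τ)² = y₁(τ²) and y₀(τ²) ≠ η(τ)² for all τ ∈ V. Then for all τ ∈ V: η'(τ) = η(τ)·(A·(η(τ)²−τ²)·(y₀(τ²)−1) + (1−B)·(η(τ)²−1)·(y₀(τ²)−τ²)) / (τ(τ²−1)(y₀(τ²)−η(τ)²)). -/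
/-- The derivative formula for `η(τ) = √(y₁(τ²))` in terms of `η` and `y₀`. -/
theorem eta_derivative
    (A B : ℂ) (U : Set ℂ) (y₁ : ℂ → ℂ)
    (hy₁ : IsPVISolutionOn 0 A B 1 y₁ U)
    (hZ : ∀ t ∈ U, okZ 0 A (-B) y₁ t ≠ 0)
    (y₀ : ℂ → ℂ) (hy₀def : ∀ t ∈ U, y₀ t = okK 0 A (-B) 1 y₁ t)
    (V : Set ℂ) (hVopen : IsOpen V)
    (hV : ∀ τ ∈ V, τ^2 ∈ U ∧ τ * (τ^2 - 1) ≠ 0)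
    (η : ℂ → ℂ) (hηdiff : ∀ τ ∈ V, DifferentiableAt ℂ η τ)
    (hη : ∀ τ ∈ V, (η τ)^2 = y₁ (τ^2) ∧ y₀ (τ^2) ≠ (η τ)^2) :
    ∀ τ ∈ V, deriv η τ =
      η τ * (A * ((η τ)^2 - τ^2) * (y₀ (τ^2) - 1)
          + (1-B) * ((η τ)^2 - 1) * (y₀ (τ^2) - τ^2))
        / (τ * (τ^2 - 1) * (y₀ (τ^2) - (η τ)^2)) := by
  intro τ hτ
  obtain ⟨hU, hne⟩ := hV τ hτ
  obtain ⟨hsq, hy0ne⟩ := hη τ hτ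
  obtain ⟨-, hpts, hdiff, -⟩ := hy₁
  obtain ⟨ht0, ht1, hy0, hy1, hyt⟩ := hpts _ hU
  have hdy := (hdiff _ hU).1
  have hz := hZ _ hU
  have hk := hy₀def _ hU
  have hτ0 : τ ≠ 0 := left_ne_zero_of_mul hne
  have hτ1 : τ^2 - 1 ≠ 0 := right_ne_zero_of_mul hne
  -- differentiate the relation `η² = y₁(τ²)`
  have h1 : HasDerivAt (fun s => (η s)^2) (2 * η τ * deriv η τ) τ := by
    have := (hηdiff τ hτ).hasDerivAt.pow 2
    have h' : (2 * η τ * deriv η τ) = ((2 : ℕ) : ℂ) * η τ ^ (2 - 1) * deriv η τ := by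
      norm_num
    rw [h']
    exact this
  have h2 : HasDerivAt (fun s : ℂ => y₁ (s^2)) (deriv y₁ (τ^2) * (2 * τ)) τ := by
    have hp : HasDerivAt (fun s : ℂ => s^2) (2 * τ) τ := by
      simpa using hasDerivAt_pow 2 τ
    exact hdy.hasDerivAt.comp τ hp
  have heq : (fun s => (η s)^2) =ᶠ[nhds τ] (fun s : ℂ => y₁ (s^2)) := by
    filter_upwards [hVopen.mem_nhds hτ] with s hs using (hη s hs).1
  have h3 : 2 * η τ * deriv η τ = deriv y₁ (τ^2) * (2 * τ) :=
    h1.unique (h2.congr_of_eventuallyEq heq)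
  have hη0 : η τ ≠ 0 := by
    intro h
    rw [h] at hsq
    exact hy0 (by rw [← hsq]; ring)
  unfold okK at hk
  have hZe : okZ 0 A (-B) y₁ (τ^2) * (y₁ (τ^2) * (y₁ (τ^2) - 1) * (y₁ (τ^2) - τ^2))
      = deriv y₁ (τ^2) * τ^2 * (τ^2 - 1) - A * y₁ (τ^2) * (y₁ (τ^2) - τ^2)
        - (1 - B) * y₁ (τ^2) * (y₁ (τ^2) - 1) := by
    have a := sub_ne_zero.mpr hy1
    have b := sub_ne_zero.mpr hyt
    unfold okZ
    field_simp
    ring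
  rw [← hsq] at hk hZe
  generalize okZ 0 A (-B) y₁ (τ^2) = Z at hk hZe hz
  generalize deriv y₁ (τ^2) = p at h3 hZe
  generalize y₀ (τ^2) = w at hk hy0ne ⊢
  generalize deriv η τ = d at h3 ⊢
  generalize η τ = e at *
  have hk' : (w - e^2) * Z = A + 1 - B := by
    rw [hk]
    field_simp
    ring
  have hw : w - e^2 ≠ 0 := sub_ne_zero.mpr hy0ne
  rw [eq_div_iff (mul_ne_zero hne hw)]
  apply mul_left_cancel₀ hη0
  linear_combination (τ * (τ^2 - 1) * (w - e^2) / 2) * h3 - (w - e^2) * hZe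
    + e^2 * (e^2 - 1) * (e^2 - τ^2) * hk'
end

section
/- Let a, b ∈ ℂ. Suppose Y₁ is a solution of P_VI((a+b−1)/2, (b−a)/2, (b−a)/2, (a+b+1)/2; T₁) on an open set W ⊆ ℂ, and that Y₂ = K_{[(a+b−1)/2, (a−b)/2, (a−b)/2, (a+b+1)/2; T₁]} Y₁ and Y₀ = K_{[(1−a−b)/2, (a−b)/2, (a−b)/2, (a+b+1)/2; T₁]} Y₁ are both defined on W. Assume (a−b+1)Y₁(T₁) + (a+b−1)Y₂(T₁) ≠ 0 on W. Then for all T₁ ∈ W: Y₀(T₁) = 2a·Y₁(T₁)·Y₂(T₁) / ((a−b+1)Y₁(T₁) + (a+b−1)Y₂(T₁)). -/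
/-- The contiguous relation `Y₀ = 2a·Y₁·Y₂ / ((a−b+1)Y₁ + (a+b−1)Y₂)`. -/
theorem contiguous_relation_Y0
    (a b : ℂ) (W : Set ℂ) (Y₁ : ℂ → ℂ)
    (hY₁ : IsPVISolutionOn ((a+b-1)/2) ((b-a)/2) ((b-a)/2) ((a+b+1)/2) Y₁ W)
    (hZ2 : ∀ T ∈ W, okZ ((a+b-1)/2) ((a-b)/2) ((a-b)/2) Y₁ T ≠ 0)
    (hZ0 : ∀ T ∈ W, okZ ((1-a-b)/2) ((a-b)/2) ((a-b)/2) Y₁ T ≠ 0)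
    (Y₂ Y₀ : ℂ → ℂ)
    (hY₂def : ∀ T ∈ W, Y₂ T = okK ((a+b-1)/2) ((a-b)/2) ((a-b)/2) ((a+b+1)/2) Y₁ T)
    (hY₀def : ∀ T ∈ W, Y₀ T = okK ((1-a-b)/2) ((a-b)/2) ((a-b)/2) ((a+b+1)/2) Y₁ T)
    (hden : ∀ T ∈ W, (a-b+1) * Y₁ T + (a+b-1) * Y₂ T ≠ 0) :
    ∀ T ∈ W, Y₀ T = 2*a * Y₁ T * Y₂ T / ((a-b+1) * Y₁ T + (a+b-1) * Y₂ T) := by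
  intro T hT
  obtain ⟨-, hne, -, -⟩ := hY₁
  obtain ⟨-, -, hy, -, -⟩ := hne T hT
  have h2 := hZ2 T hT
  have h0 := hZ0 T hT
  have hd := hden T hT
  have e2 := hY₂def T hT
  have e0 := hY₀def T hT
  have hZ : okZ ((1-a-b)/2) ((a-b)/2) ((a-b)/2) Y₁ T
      = okZ ((a+b-1)/2) ((a-b)/2) ((a-b)/2) Y₁ T + (a+b-1) / Y₁ T := by
    unfold okZ
    ring
  unfold okK at e2 e0
  rw [hZ] at h0 e0
  generalize okZ ((a+b-1)/2) ((a-b)/2) ((a-b)/2) Y₁ T = Z at *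
  generalize Y₁ T = y at *
  have h0' : Z * y + (a+b-1) ≠ 0 := by
    intro h
    apply h0
    have : Z + (a+b-1) / y = (Z * y + (a+b-1)) / y := by field_simp
    rw [this, h, zero_div]
  have e2' : Y₂ T * Z = y * Z + 2*a := by
    rw [e2]
    field_simp
    ring
  have e0' : Y₀ T * (Z * y + (a+b-1)) = y * (y * Z + 2*a) := by
    have : Z + (a+b-1) / y = (Z * y + (a+b-1)) / y := by field_simp
    rw [e0, this]
    obtain ⟨D, hD⟩ : ∃ D, D = Z * y + (a+b-1) := ⟨_, rfl⟩
    rw [← hD] at h0' ⊢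
    field_simp
    rw [hD]
    ring
  rw [eq_div_iff hd]
  apply mul_right_cancel₀ h2
  linear_combination (Y₀ T * (a+b-1) - 2*a*y) * e2' + 2*a * e0'
end

section
/- Let a, b ∈ ℂ. Suppose y₀ is a solution of P_VI(a, b−1, b, a+1; t₁) on an open set U ⊆ ℂ, and y₁ = K_{[−a, b−1, −b, 1−a; t₁]} y₀ is defined on U. Let V ⊆ ℂ be open with τ² ∈ U, τ ∉ {0,1,−1} for τ ∈ V, and let η : V → ℂ be differentiable with η(τ)² = y₁(τ²). Assume a·η(τ)·(y₀(τ²)−τ²) + b·τ·(y₀(τ²)−η(τ)²) ≠ 0 on V. Suppose Ỹ₀ is twice differentiable on a neighbourhood of {(τ+1)²/(τ−1)² : τ ∈ V}, satisfies Ỹ₀((τ+1)²/(τ−1)²) = a(τ+1)(η(τ)+τ)(y₀(τ²)+η(τ)τ) / ((1−τ)(a·η(τ)(y₀(τ²)−τ²) + b·τ(y₀(τ²)−η(τ)²))) for all τ ∈ V, and avoids 0, 1 and its argument where the argument lies outside {0,1}. Then Ỹ₀ satisfies P_VI(a, 1/2, 1/2, b+1; T₁) at every T₁ = (τ+1)²/(τ−1)²,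 τ ∈ V. -/
/-- Hamiltonian momentum equation deduced from the Painlevé VI equation. -/
lemma okZ_hasDerivAt_s11 (a b : ℂ) (y : ℂ → ℂ) (t : ℂ) (ht0 : t ≠ 0) (ht1 : t ≠ 1)
    (hy0 : y t ≠ 0) (hy1 : y t ≠ 1) (hyt : y t ≠ t)
    (hd : DifferentiableAt ℂ y t) (hdd : DifferentiableAt ℂ (deriv y) t)
    (h : PVIAt a (b-1) b (a+1) y t) (p : ℂ) (hp : okZ (-a) (b-1) (-b) y t = 2 * p) :
    HasDerivAt (fun t => okZ (-a) (b-1) (-b) y t / 2)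
      ((-(3*(y t)^2-2*(1+t)*y t+t)*p^2 + (a*(2*y t-1-t) - (1-b)*(t-1))*p)/(t*(t-1))) t := by
  have h0 := hd.hasDerivAt
  have h1 := hdd.hasDerivAt
  have hi := hasDerivAt_id t
  have e1 : y t - 1 ≠ 0 := sub_ne_zero.2 hy1
  have e2 : y t - t ≠ 0 := sub_ne_zero.2 hyt
  have e3 : t - 1 ≠ 0 := sub_ne_zero.2 ht1
  have key := (((((hi.sub_const 1).mul h1).sub_const (-a)).div h0 hy0).sub
    (((hi.mul h1).add_const (b-1)).div (h0.sub_const 1) e1)).add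
    (((h1.sub_const 1).sub_const (-b)).div (h0.sub hi) e2)
  have key2 := key.div_const 2
  refine (key2.congr_deriv ?_)
  unfold PVIAt pviRHS at h
  simp only [Pi.sub_apply, id, Pi.mul_apply]
  rw [h]
  have hp' : p = okZ (-a) (b-1) (-b) y t / 2 := by rw [hp]; ring
  rw [hp']
  unfold okZ
  generalize deriv y t = m at *
  generalize y t = z at *
  field_simp
  ring

lemma okZ_deriv_eq (a b : ℂ) (y : ℂ → ℂ) (t : ℂ) (ht0 : t ≠ 0) (ht1 : t ≠ 1)
    (hy0 : y t ≠ 0) (hy1 : y t ≠ 1) (hyt : y t ≠ t)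
    (p : ℂ) (hp : okZ (-a) (b-1) (-b) y t = 2 * p) :
    deriv y t = (2*y t*(y t-1)*(y t-t)*p - a*(y t-1)*(y t-t) + (1-b)*(t-1)*y t)/(t*(t-1)) := by
  have e1 : y t - 1 ≠ 0 := sub_ne_zero.2 hy1
  have e2 : y t - t ≠ 0 := sub_ne_zero.2 hyt
  have e3 : t - 1 ≠ 0 := sub_ne_zero.2 ht1
  have hp' : p = okZ (-a) (b-1) (-b) y t / 2 := by rw [hp]; ring
  rw [hp']
  unfold okZ
  generalize deriv y t = m at *
  generalize y t = z at *
  field_simp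
  ring

/-- A function satisfying the Hamiltonian system satisfies Painlevé VI. -/
lemma ham_to_pvi (a b : ℂ) (u T P : ℂ → ℂ) (s T' : ℂ) (hT' : T' ≠ 0)
    (hT : HasDerivAt T T' s) (hT0 : T s ≠ 0) (hT1 : T s ≠ 1)
    (hu0 : u (T s) ≠ 0) (hu1 : u (T s) ≠ 1) (hut : u (T s) ≠ T s)
    (hd : DifferentiableAt ℂ u (T s)) (hdd : DifferentiableAt ℂ (deriv u) (T s))
    (hG : ∀ᶠ x in nhds s, deriv u (T x) = (2*u (T x)*(u (T x)-1)*(u (T x)-T x)*P x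
      - a*(u (T x)-1)*(u (T x)-T x) + 1/2*u (T x)*(T x-1))/(T x*(T x-1)))
    (hP : HasDerivAt P (T' * ((-(3*(u (T s))^2-2*(1+T s)*u (T s)+T s)*(P s)^2
      + (a*(2*u (T s)-1-T s)-1/2*(T s-1))*P s - (a^2-b^2)/4)/(T s*(T s-1)))) s) :
    PVIAt a (1/2) (1/2) (b+1) u (T s) := by
  have e1 : u (T s) - 1 ≠ 0 := sub_ne_zero.2 hu1
  have e2 : u (T s) - T s ≠ 0 := sub_ne_zero.2 hut
  have e3 : T s - 1 ≠ 0 := sub_ne_zero.2 hT1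
  have hu : HasDerivAt (fun x => u (T x)) (deriv u (T s) * T') s := hd.hasDerivAt.comp s hT
  have hu2 : HasDerivAt (fun x => deriv u (T x)) (deriv (deriv u) (T s) * T') s :=
    hdd.hasDerivAt.comp s hT
  have k := (((((((hu.const_mul 2).mul (hu.sub_const 1)).mul (hu.sub hT)).mul hP).sub
    (((hu.sub_const 1).const_mul a).mul (hu.sub hT))).add
    ((hu.const_mul (1/2)).mul (hT.sub_const 1))).div (hT.mul (hT.sub_const 1))
    (mul_ne_zero hT0 e3))
  have k2 := (k.congr_of_eventuallyEq (f₁ := fun x => deriv u (T x)) (by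
    filter_upwards [hG] with x hx
    rw [hx]
    simp only [Pi.add_apply, Pi.sub_apply, Pi.mul_apply, Pi.div_apply])).unique hu2
  have hGs := hG.self_of_nhds
  unfold PVIAt pviRHS
  simp only [Pi.add_apply, Pi.sub_apply, Pi.mul_apply] at k2
  rw [hGs] at k2 ⊢
  generalize deriv (deriv u) (T s) = m at *
  apply mul_right_cancel₀ hT'
  rw [← k2]
  clear k2 k hu2 hu hP hG hT hGs
  generalize P s = p at *
  generalize u (T s) = z at *
  generalize T s = t at *
  field_simp
  ring

/-- The vector field of the reduced system, first component. -/
noncomputable def vfE (a b s e w : ℂ) : ℂ :=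
  (2*(e^2-1)*(e^2-s^2)*w + a*e*(2*e^2-1-s^2) + (1-b)*(s^2-1)*e)/(s*(s^2-1))

/-- The vector field of the reduced system, second component. -/
noncomputable def vfW (a b s e w : ℂ) : ℂ :=
  (-2*e*w^2*(2*e^2-1-s^2) - a*w*(6*e^2-1-s^2) - (1-b)*(s^2-1)*w - 2*a^2*e)/(s*(s^2-1))

lemma T_hasDerivAt (s : ℂ) (h1 : s ≠ 1) :
    HasDerivAt (fun x : ℂ => (x+1)^2/(x-1)^2) (-4*(s+1)/(s-1)^3) s := by
  have e3 : s - 1 ≠ 0 := sub_ne_zero.2 h1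
  have hi := hasDerivAt_id s
  have k := ((hi.add_const 1).pow 2).div ((hi.sub_const 1).pow 2) (pow_ne_zero 2 e3)
  refine k.congr_deriv ?_
  simp only [id, Pi.pow_apply]
  field_simp
  ring

/-- The quantity `A` in the denominator. -/
noncomputable def qA (a b s e w : ℂ) : ℂ := (e^2-s^2)*w + a*e + b*s

lemma qA_hasDerivAt (a b s : ℂ) (e w : ℂ → ℂ) (e' w' : ℂ)
    (he : HasDerivAt e e' s) (hw : HasDerivAt w w' s) :
    HasDerivAt (fun x => qA a b x (e x) (w x))
      ((2*e s*e' - 2*s)*w s + ((e s)^2-s^2)*w' + a*e' + b) s := by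
  have hi := hasDerivAt_id s
  have k := ((((he.pow 2).sub (hi.pow 2)).mul hw).add (he.const_mul a)).add (hi.const_mul b)
  refine k.congr_deriv ?_
  simp only [id, Pi.pow_apply, Pi.sub_apply]
  norm_num

/-- The transformed solution in reduced variables. -/
noncomputable def qY (a b s e w : ℂ) : ℂ :=
  (s+1)*(e+s)*((e+s)*w+a)/((1-s)*qA a b s e w)

/-- The transformed momentum in reduced variables. -/
noncomputable def qP (a b s e w : ℂ) : ℂ :=
  (s-1)*(e-s)*qA a b s e w/(2*s*(s+1)*(e+s))

lemma qY_hasDerivAt (a b s : ℂ) (e w : ℂ → ℂ) (h0 : s ≠ 0) (h1 : s ≠ 1) (hm : s ≠ -1)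
    (hA : qA a b s (e s) (w s) ≠ 0) (hes : e s + s ≠ 0)
    (he : HasDerivAt e (vfE a b s (e s) (w s)) s) (hw : HasDerivAt w (vfW a b s (e s) (w s)) s)
    (T Y P : ℂ) (hT : T = (s+1)^2/(s-1)^2) (hY : Y = qY a b s (e s) (w s))
    (hP : P = qP a b s (e s) (w s)) :
    HasDerivAt (fun x => qY a b x (e x) (w x))
      ((2*Y*(Y-1)*(Y-T)*P - a*(Y-1)*(Y-T) + 1/2*Y*(T-1))/(T*(T-1)) * (-4*(s+1)/(s-1)^3)) s := by
  have e1 : 1 - s ≠ 0 := sub_ne_zero.2 h1.symm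
  have e3 : s - 1 ≠ 0 := sub_ne_zero.2 h1
  have e2 : s + 1 ≠ 0 := fun h => hm (eq_neg_of_add_eq_zero_left h)
  have e4 : s^2 - 1 ≠ 0 := by
    have : s^2 - 1 = (s-1)*(s+1) := by ring
    rw [this]; exact mul_ne_zero e3 e2
  have hi := hasDerivAt_id s
  have hAd := qA_hasDerivAt a b s e w _ _ he hw
  have k := (((hi.add_const 1).mul (he.add hi)).mul (((he.add hi).mul hw).add_const a)).div
    ((hi.const_sub 1).mul hAd) (mul_ne_zero e1 hA)
  refine k.congr_deriv ?_
  simp only [id, Pi.mul_apply, Pi.sub_apply, Pi.add_apply]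
  clear k hAd he hw
  generalize e s = e at *
  generalize w s = w at *
  have hT1 : T - 1 = 4*s/(s-1)^2 := by rw [hT]; field_simp; ring
  have hY1 : Y - 1 = s*(2*(e+1)*(e+s)*w + a*(2*e+s+1)+b*(s-1))/((1-s)*qA a b s e w) := by
    rw [hY]; unfold qY; field_simp; unfold qA; ring
  have hYT : Y - T = s*(s+1)*(2*(e-1)*(e+s)*w + a*(2*e+s-1)+b*(s+1))/((s-1)*((1-s)*qA a b s e w)) := by
    rw [hY, hT]; unfold qY; field_simp; unfold qA; ring
  rw [hT1, hY1, hYT, hY, hT, hP]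
  unfold qY qP vfE vfW
  obtain ⟨A, hAe⟩ : ∃ A, A = qA a b s e w := ⟨_, rfl⟩
  rw [← hAe] at hA ⊢
  unfold qA at hAe
  field_simp
  rw [hAe]
  ring

lemma qP_hasDerivAt (a b s : ℂ) (e w : ℂ → ℂ) (h0 : s ≠ 0) (h1 : s ≠ 1) (hm : s ≠ -1)
    (hA : qA a b s (e s) (w s) ≠ 0) (hes : e s + s ≠ 0)
    (he : HasDerivAt e (vfE a b s (e s) (w s)) s) (hw : HasDerivAt w (vfW a b s (e s) (w s)) s)
    (T Y P : ℂ) (hT : T = (s+1)^2/(s-1)^2) (hY : Y = qY a b s (e s) (w s))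
    (hP : P = qP a b s (e s) (w s)) :
    HasDerivAt (fun x => qP a b x (e x) (w x))
      ((-4*(s+1)/(s-1)^3) * ((-(3*Y^2-2*(1+T)*Y+T)*P^2
      + (a*(2*Y-1-T)-1/2*(T-1))*P - (a^2-b^2)/4)/(T*(T-1)))) s := by
  have e1 : 1 - s ≠ 0 := sub_ne_zero.2 h1.symm
  have e3 : s - 1 ≠ 0 := sub_ne_zero.2 h1
  have e2 : s + 1 ≠ 0 := fun h => hm (eq_neg_of_add_eq_zero_left h)
  have e4 : s^2 - 1 ≠ 0 := by
    have : s^2 - 1 = (s-1)*(s+1) := by ring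
    rw [this]; exact mul_ne_zero e3 e2
  have hi := hasDerivAt_id s
  have hAd := qA_hasDerivAt a b s e w _ _ he hw
  have k := (((hi.sub_const 1).mul (he.sub hi)).mul hAd).div
    (((hi.const_mul 2).mul (hi.add_const 1)).mul (he.add hi))
    (mul_ne_zero (mul_ne_zero (mul_ne_zero two_ne_zero h0) e2) hes)
  refine k.congr_deriv ?_
  simp only [id, Pi.mul_apply, Pi.sub_apply, Pi.add_apply]
  clear k hAd he hw
  generalize e s = e at *
  generalize w s = w at *
  have hT1 : T - 1 = 4*s/(s-1)^2 := by rw [hT]; field_simp; ring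
  have hYP : Y * P = -((e-s)*((e+s)*w+a)/(2*s)) := by
    rw [hY, hP]; unfold qY qP; field_simp; ring
  have hx : -(3*Y^2-2*(1+T)*Y+T)*P^2 + (a*(2*Y-1-T)-1/2*(T-1))*P
     = -3*(Y*P)^2 + 2*(1+T)*(Y*P)*P - T*P^2 + 2*a*(Y*P) - (a*(1+T)+1/2*(T-1))*P := by ring
  rw [hx, hYP, hT1, hT, hP]
  unfold qP vfE vfW
  obtain ⟨A, hAe⟩ : ∃ A, A = qA a b s e w := ⟨_, rfl⟩
  rw [← hAe] at hA ⊢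
  unfold qA at hAe
  field_simp
  rw [hAe]
  ring

/-- If two continuous expressions agree where an analytic function is nonzero, and also
where it vanishes locally, they agree. -/
lemma eq_of_mul_eq {V : Set ℂ} (hV : IsOpen V) (η F : ℂ → ℂ)
    (hη : ∀ x ∈ V, DifferentiableAt ℂ η x) (hF : ∀ x ∈ V, ContinuousAt F x)
    (hF0 : ∀ x ∈ V, η x = 0 → F x = 0)
    (h : ∀ x ∈ V, η x * deriv η x = η x * F x) : ∀ x ∈ V, deriv η x = F x := by
  intro s hs
  have hd : DifferentiableOn ℂ η V := fun x hx => (hη x hx).differentiableWithinAt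
  have han : AnalyticAt ℂ η s := hd.analyticAt (hV.mem_nhds hs)
  rcases han.eventually_eq_zero_or_eventually_ne_zero with h0 | h0
  · have h1 : η =ᶠ[nhds s] fun _ => (0:ℂ) := h0
    rw [h1.deriv_eq, hF0 s hs h0.self_of_nhds]
    simp
  · have hc : ContinuousAt (deriv η) s := han.deriv.continuousAt
    have t1 : Filter.Tendsto (deriv η) (nhdsWithin s {s}ᶜ) (nhds (deriv η s)) :=
      hc.tendsto.mono_left nhdsWithin_le_nhds
    have t2 : Filter.Tendsto F (nhdsWithin s {s}ᶜ) (nhds (F s)) :=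
      (hF s hs).tendsto.mono_left nhdsWithin_le_nhds
    refine tendsto_nhds_unique (t1.congr' ?_) t2
    have hVn : ∀ᶠ x in nhdsWithin s {s}ᶜ, x ∈ V :=
      nhdsWithin_le_nhds (hV.mem_nhds hs)
    filter_upwards [h0, hVn] with x hx hxV
    exact mul_left_cancel₀ hx (h x hxV)

lemma reduced_system (a b : ℂ) (U : Set ℂ) (y₀ : ℂ → ℂ)
    (hy₀ : IsPVISolutionOn a (b-1) b (a+1) y₀ U)
    (hZ : ∀ t ∈ U, okZ (-a) (b-1) (-b) y₀ t ≠ 0)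
    (V : Set ℂ) (hVopen : IsOpen V)
    (hV : ∀ τ ∈ V, τ^2 ∈ U ∧ τ ≠ 0 ∧ τ ≠ 1 ∧ τ ≠ -1)
    (η : ℂ → ℂ) (hηdiff : ∀ τ ∈ V, DifferentiableAt ℂ η τ)
    (hη : ∀ τ ∈ V, (η τ)^2 = y₀ (τ^2) - a / (okZ (-a) (b-1) (-b) y₀ (τ^2) / 2))
    (w : ℂ → ℂ) (hw : ∀ x, w x = η x * (okZ (-a) (b-1) (-b) y₀ (x^2) / 2)) :
    ∀ s ∈ V, HasDerivAt η (vfE a b s (η s) (w s)) s ∧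
      HasDerivAt w (vfW a b s (η s) (w s)) s := by
  obtain ⟨-, hne, hdf, hpv⟩ := hy₀
  obtain ⟨p, hp⟩ : ∃ p : ℂ → ℂ, ∀ x, p x = okZ (-a) (b-1) (-b) y₀ (x^2) / 2 :=
    ⟨_, fun _ => rfl⟩
  have hp0 : ∀ s ∈ V, p s ≠ 0 := fun s hs => by
    rw [hp]; exact div_ne_zero (hZ _ (hV s hs).1) two_ne_zero
  have hyp : ∀ s ∈ V, y₀ (s^2) = (η s)^2 + a / p s := fun s hs => by
    rw [hη s hs, hp]; ring
  have hsq : ∀ s : ℂ, HasDerivAt (fun x : ℂ => x^2) (2*s) s := fun s => by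
    simpa using hasDerivAt_pow 2 s
  have hs4 : ∀ s ∈ V, s^2 - 1 ≠ 0 := fun s hs => sub_ne_zero.2 (hne _ (hV s hs).1).2.1
  have hpd : ∀ s ∈ V, HasDerivAt p
      ((-(3*(y₀ (s^2))^2-2*(1+s^2)*y₀ (s^2)+s^2)*(p s)^2
        + (a*(2*y₀ (s^2)-1-s^2) - (1-b)*(s^2-1))*p s)/(s^2*(s^2-1)) * (2*s)) s := by
    intro s hs
    have hU := (hV s hs).1
    obtain ⟨n1, n2, n3, n4, n5⟩ := hne _ hU
    have k := okZ_hasDerivAt_s11 a b y₀ (s^2) n1 n2 n3 n4 n5 (hdf _ hU).1 (hdf _ hU).2 (hpv _ hU)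
      (p s) (by rw [hp]; ring)
    have k2 := HasDerivAt.comp s k (hsq s)
    exact k2.congr_of_eventuallyEq (Filter.Eventually.of_forall fun x => hp x)
  have hyd : ∀ s ∈ V, HasDerivAt (fun x => y₀ (x^2))
      ((2*y₀ (s^2)*(y₀ (s^2)-1)*(y₀ (s^2)-s^2)*p s - a*(y₀ (s^2)-1)*(y₀ (s^2)-s^2)
        + (1-b)*(s^2-1)*y₀ (s^2))/(s^2*(s^2-1)) * (2*s)) s := by
    intro s hs
    have hU := (hV s hs).1
    obtain ⟨n1, n2, n3, n4, n5⟩ := hne _ hU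
    have k := okZ_deriv_eq a b y₀ (s^2) n1 n2 n3 n4 n5 (p s) (by rw [hp]; ring)
    rw [← k]
    exact HasDerivAt.comp s (hdf _ hU).1.hasDerivAt (hsq s)
  have hw' : ∀ x, w x = η x * p x := fun x => by rw [hw, hp]
  have hηd : ∀ s ∈ V, deriv η s = vfE a b s (η s) (η s * p s) := by
    apply eq_of_mul_eq hVopen η (fun s => vfE a b s (η s) (η s * p s)) hηdiff
    · intro x hx
      have c1 := (hηdiff x hx).continuousAt
      have c2 := (hpd x hx).continuousAt
      have c3 : x * (x^2-1) ≠ 0 := mul_ne_zero (hV x hx).2.1 (hs4 x hx)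
      unfold vfE
      refine ContinuousAt.div ?_ ?_ c3 <;> fun_prop
    · intro x _ h0
      simp [vfE, h0]
    · intro s hs
      have d1 := ((hηdiff s hs).hasDerivAt.pow 2)
      have d2 := (hyd s hs).sub ((hasDerivAt_const s a).div (hpd s hs) (hp0 s hs))
      have d3 := (d1.congr_of_eventuallyEq (f₁ := fun x => y₀ (x^2) - a / p x) (by
        filter_upwards [hVopen.mem_nhds hs] with x hx
        simp only [Pi.pow_apply]
        rw [hyp x hx]; ring)).unique d2
      have n0 := (hV s hs).2.1
      have n4 := hs4 s hs
      have np := hp0 s hs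
      rw [hyp s hs] at d3
      have d4 : η s * deriv η s = (1/2) * ((2:ℕ) * η s ^ (2-1) * deriv η s) := by
        norm_num
        ring
      rw [d4, d3]
      unfold vfE
      clear d4 d3 d2 d1
      generalize η s = e at *
      generalize p s = p at *
      field_simp
      ring
  intro s hs
  have hE : HasDerivAt η (vfE a b s (η s) (w s)) s := by
    rw [hw', ← hηd s hs]; exact (hηdiff s hs).hasDerivAt
  refine ⟨hE, ?_⟩
  have hwf : w = fun x => η x * p x := funext hw'
  have k := hE.mul (hpd s hs)
  rw [hwf] at k ⊢
  refine k.congr_deriv ?_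
  have n0 := (hV s hs).2.1
  have n4 := hs4 s hs
  have np := hp0 s hs
  rw [hyp s hs]
  unfold vfE vfW
  clear k hE
  simp only []
  generalize η s = e at *
  generalize p s = p at *
  field_simp
  ring

/-- The variant quadratic transformation yielding a solution of
`P_VI(a,1/2,1/2,b+1;T₁)` (formula (33) of Vidunas–Kitaev). -/
theorem quadratic_transformation_variant
    (a b : ℂ) (U : Set ℂ) (y₀ : ℂ → ℂ)
    (hy₀ : IsPVISolutionOn a (b-1) b (a+1) y₀ U)
    (hZ : ∀ t ∈ U, okZ (-a) (b-1) (-b) y₀ t ≠ 0)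
    (y₁ : ℂ → ℂ) (hy₁def : ∀ t ∈ U, y₁ t = okK (-a) (b-1) (-b) (1-a) y₀ t)
    (V : Set ℂ) (hVopen : IsOpen V)
    (hV : ∀ τ ∈ V, τ^2 ∈ U ∧ τ ≠ 0 ∧ τ ≠ 1 ∧ τ ≠ -1)
    (η : ℂ → ℂ) (hηdiff : ∀ τ ∈ V, DifferentiableAt ℂ η τ)
    (hη : ∀ τ ∈ V, (η τ)^2 = y₁ (τ^2))
    (hden : ∀ τ ∈ V, a * η τ * (y₀ (τ^2) - τ^2) + b * τ * (y₀ (τ^2) - (η τ)^2) ≠ 0)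
    (Ytil : ℂ → ℂ) (W : Set ℂ) (hWopen : IsOpen W)
    (hWsub : ∀ τ ∈ V, (τ+1)^2/(τ-1)^2 ∈ W)
    (hYdiff : ∀ T ∈ W, DifferentiableAt ℂ Ytil T ∧ DifferentiableAt ℂ (deriv Ytil) T)
    (hYeq : ∀ τ ∈ V, Ytil ((τ+1)^2/(τ-1)^2) =
      a*(τ+1)*(η τ+τ)*(y₀ (τ^2)+η τ*τ) /
        ((1-τ)*(a*η τ*(y₀ (τ^2)-τ^2) + b*τ*(y₀ (τ^2)-(η τ)^2))))
    (havoid : ∀ τ ∈ V, (τ+1)^2/(τ-1)^2 ≠ 0 ∧ (τ+1)^2/(τ-1)^2 ≠ 1 ∧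
      Ytil ((τ+1)^2/(τ-1)^2) ≠ 0 ∧ Ytil ((τ+1)^2/(τ-1)^2) ≠ 1 ∧
      Ytil ((τ+1)^2/(τ-1)^2) ≠ (τ+1)^2/(τ-1)^2) :
    ∀ τ ∈ V, PVIAt a (1/2) (1/2) (b+1) Ytil ((τ+1)^2/(τ-1)^2) := by
  intro τ hτ
  obtain ⟨p, hp⟩ : ∃ p : ℂ → ℂ, ∀ x, p x = okZ (-a) (b-1) (-b) y₀ (x^2) / 2 :=
    ⟨_, fun _ => rfl⟩
  have hp0 : ∀ s ∈ V, p s ≠ 0 := fun s hs => by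
    rw [hp]; exact div_ne_zero (hZ _ (hV s hs).1) two_ne_zero
  have hη2 : ∀ s ∈ V, (η s)^2 = y₀ (s^2) - a / p s := by
    intro s hs
    have h1 := hZ _ (hV s hs).1
    rw [hη s hs, hy₁def _ (hV s hs).1, hp]
    unfold okK
    field_simp
    ring
  obtain ⟨w, hw⟩ : ∃ w : ℂ → ℂ, ∀ x, w x = η x * p x := ⟨_, fun _ => rfl⟩
  have hsys := reduced_system a b U y₀ hy₀ hZ V hVopen hV η hηdiff
    (fun s hs => by rw [hη2 s hs, hp]) w (fun x => by rw [hw, hp])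
  have ha : a ≠ 0 := by
    rintro rfl
    apply (havoid τ hτ).2.2.1
    rw [hYeq τ hτ]
    simp
  have hes : ∀ s ∈ V, η s + s ≠ 0 := by
    intro s hs h
    apply (havoid s hs).2.2.1
    rw [hYeq s hs, h]
    simp
  have hAeq : ∀ s ∈ V, p s * (a * η s * (y₀ (s^2) - s^2) + b * s * (y₀ (s^2) - (η s)^2))
      = a * qA a b s (η s) (w s) := by
    intro s hs
    have hyp : y₀ (s^2) = (η s)^2 + a / p s := by rw [hη2 s hs]; ring
    have np := hp0 s hs
    rw [hyp, hw]
    unfold qA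
    field_simp
    ring
  have hA : ∀ s ∈ V, qA a b s (η s) (w s) ≠ 0 := by
    intro s hs h
    have := hAeq s hs
    rw [h, mul_zero] at this
    exact mul_ne_zero (hp0 s hs) (hden s hs) this
  have hYq : ∀ s ∈ V, Ytil ((s+1)^2/(s-1)^2) = qY a b s (η s) (w s) := by
    intro s hs
    have np := hp0 s hs
    have hyp : y₀ (s^2) = (η s)^2 + a / p s := by rw [hη2 s hs]; ring
    have e1 : 1 - s ≠ 0 := sub_ne_zero.2 (hV s hs).2.2.1.symm
    have hN : p s * (y₀ (s^2) + η s * s) = (η s + s) * w s + a := by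
      rw [hyp, hw]; field_simp; ring
    rw [hYeq s hs]
    unfold qY
    rw [div_eq_div_iff (mul_ne_zero e1 (hden s hs)) (mul_ne_zero e1 (hA s hs)), ← hN]
    linear_combination (-(s+1) * (η s + s) * (y₀ (s^2) + η s * s) * (1-s)) * hAeq s hs
  have hT' : ∀ s ∈ V, -4*(s+1)/(s-1)^3 ≠ 0 := by
    intro s hs
    have e3 : s - 1 ≠ 0 := sub_ne_zero.2 (hV s hs).2.2.1
    have e2 : s + 1 ≠ 0 := fun h => (hV s hs).2.2.2 (eq_neg_of_add_eq_zero_left h)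
    exact div_ne_zero (mul_ne_zero (by norm_num) e2) (pow_ne_zero 3 e3)
  have hG : ∀ s ∈ V, deriv Ytil ((s+1)^2/(s-1)^2) =
      (2*Ytil ((s+1)^2/(s-1)^2)*(Ytil ((s+1)^2/(s-1)^2)-1)
          *(Ytil ((s+1)^2/(s-1)^2)-(s+1)^2/(s-1)^2)*qP a b s (η s) (w s)
        - a*(Ytil ((s+1)^2/(s-1)^2)-1)*(Ytil ((s+1)^2/(s-1)^2)-(s+1)^2/(s-1)^2)
        + 1/2*Ytil ((s+1)^2/(s-1)^2)*((s+1)^2/(s-1)^2-1))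
        /((s+1)^2/(s-1)^2*((s+1)^2/(s-1)^2-1)) := by
    intro s hs
    obtain ⟨-, n0, n1, nm⟩ := hV s hs
    have k := qY_hasDerivAt a b s η w n0 n1 nm (hA s hs) (hes s hs) (hsys s hs).1 (hsys s hs).2
      _ _ _ rfl (hYq s hs) rfl
    have hd := (hYdiff _ (hWsub s hs)).1.hasDerivAt
    have k2 : HasDerivAt (fun x => Ytil ((x+1)^2/(x-1)^2)) _ s :=
      HasDerivAt.comp s hd (T_hasDerivAt s n1)
    have k3 := (k.congr_of_eventuallyEq (f₁ := fun x => Ytil ((x+1)^2/(x-1)^2)) (by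
      filter_upwards [hVopen.mem_nhds hs] with x hx
      exact hYq x hx)).unique k2
    exact (mul_right_cancel₀ (hT' s hs) k3).symm
  obtain ⟨-, n0, n1, nm⟩ := hV τ hτ
  obtain ⟨v1, v2, v3, v4, v5⟩ := havoid τ hτ
  have hPd := qP_hasDerivAt a b τ η w n0 n1 nm (hA τ hτ) (hes τ hτ) (hsys τ hτ).1 (hsys τ hτ).2
      _ _ _ rfl (hYq τ hτ) rfl
  exact ham_to_pvi a b Ytil (fun x => (x+1)^2/(x-1)^2) (fun x => qP a b x (η x) (w x)) τ _
    (hT' τ hτ) (T_hasDerivAt τ n1) v1 v2 v3 v4 v5 (hYdiff _ (hWsub τ hτ)).1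
    (hYdiff _ (hWsub τ hτ)).2
    (by filter_upwards [hVopen.mem_nhds hτ] with x hx using hG x hx) hPd
end
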